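/- For a commutative semigroup X the following conditions are equivalent: (1) X is absolutely T₂S-closed; (2) X is absolutely TzS-closed; (3) X is ideally T₂S-closed, injectively T₂S-closed and bounded; (4) X is ideally T₂S-closed, group-finite and bounded; (5) X is chain-finite, bounded, group-finite and Clifford+finite. -/

import Mathlib

universe u

open Set TopologicalSpace

/-- A topological space is zero-dimensional: it has a base of clopen sets. -/
def HasClopenBasis (Y : Type*) [TopologicalSpace Y] : Prop :=
  ∃ B : Set (Set Y), (∀ s ∈ B, IsClopen s) ∧ IsTopologicalBasis B

section TopClasses

variable (X : Type u) [Semigroup X]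

/-- `X` is absolutely `T₁S`-closed: the image of every homomorphism to a `T₁`
topological semigroup is closed. -/
def AbsolutelyT1SClosed : Prop :=
  ∀ (Y : Type u) [Semigroup Y] [TopologicalSpace Y] [ContinuousMul Y] [T1Space Y]
    (h : X →ₙ* Y), IsClosed (Set.range h)

/-- `X` is absolutely `T₂S`-closed. -/
def AbsolutelyT2SClosed : Prop :=
  ∀ (Y : Type u) [Semigroup Y] [TopologicalSpace Y] [ContinuousMul Y] [T2Space Y]
    (h : X →ₙ* Y), IsClosed (Set.range h)

/-- `X` is absolutely `TzS`-closed. -/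
def AbsolutelyTzSClosed : Prop :=
  ∀ (Y : Type u) [Semigroup Y] [TopologicalSpace Y] [ContinuousMul Y] [T1Space Y],
    HasClopenBasis Y → ∀ (h : X →ₙ* Y), IsClosed (Set.range h)

/-- `X` is `T₁S`-closed: the image of every injective homomorphism to a `T₁`
topological semigroup with discrete image is closed. -/
def T1SClosed : Prop :=
  ∀ (Y : Type u) [Semigroup Y] [TopologicalSpace Y] [ContinuousMul Y] [T1Space Y]
    (h : X →ₙ* Y), Function.Injective h → DiscreteTopology (Set.range h) →
      IsClosed (Set.range h)

/-- `X` is `T₂S`-closed. -/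
def T2SClosed : Prop :=
  ∀ (Y : Type u) [Semigroup Y] [TopologicalSpace Y] [ContinuousMul Y] [T2Space Y]
    (h : X →ₙ* Y), Function.Injective h → DiscreteTopology (Set.range h) →
      IsClosed (Set.range h)

/-- `X` is `TzS`-closed. -/
def TzSClosed : Prop :=
  ∀ (Y : Type u) [Semigroup Y] [TopologicalSpace Y] [ContinuousMul Y] [T1Space Y],
    HasClopenBasis Y → ∀ (h : X →ₙ* Y), Function.Injective h →
      DiscreteTopology (Set.range h) → IsClosed (Set.range h)

/-- `X` is injectively `T₂S`-closed. -/
def InjectivelyT2SClosed : Prop :=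
  ∀ (Y : Type u) [Semigroup Y] [TopologicalSpace Y] [ContinuousMul Y] [T2Space Y]
    (h : X →ₙ* Y), Function.Injective h → IsClosed (Set.range h)

/-- `X` is projectively `T₁S`-closed: all congruence quotients are `T₁S`-closed. -/
def ProjectivelyT1SClosed : Prop := ∀ c : Con X, T1SClosed c.Quotient

/-- `X` is projectively `TzS`-closed. -/
def ProjectivelyTzSClosed : Prop := ∀ c : Con X, TzSClosed c.Quotient

/-- `X` is projectively `T₁S`-discrete: every homomorphism into a `T₁`
topological semigroup has discrete image. -/
def ProjectivelyT1SDiscrete : Prop :=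
  ∀ (Y : Type u) [Semigroup Y] [TopologicalSpace Y] [ContinuousMul Y] [T1Space Y]
    (h : X →ₙ* Y), DiscreteTopology (Set.range h)

/-- `X` is projectively `TzS`-discrete. -/
def ProjectivelyTzSDiscrete : Prop :=
  ∀ (Y : Type u) [Semigroup Y] [TopologicalSpace Y] [ContinuousMul Y] [T1Space Y],
    HasClopenBasis Y → ∀ (h : X →ₙ* Y), DiscreteTopology (Set.range h)

end TopClasses

/-- `spow x n` is the power `x^(n+1)` in a semigroup; thus as `n` ranges over `ℕ`,
`spow x n` ranges over all powers `x^m`, `m ≥ 1`. -/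
def spow {X : Type*} [Semigroup X] (x : X) : ℕ → X
  | 0 => x
  | n + 1 => spow x n * x

section AlgDefs

variable (X : Type*) [Semigroup X]

/-- the set `E(X)` of idempotents. -/
def idemSet : Set X := {x | x * x = x}

/-- `H_e`, the maximal subgroup containing the idempotent `e`. -/
def maxSubgroup (e : X) : Set X :=
  {x | x * e = x ∧ e * x = x ∧ ∃ y, y * e = y ∧ e * y = y ∧ x * y = e ∧ y * x = e}

/-- The Clifford part `H(X) = ⋃_{e ∈ E(X)} H_e`. -/
def cliffordPart : Set X := ⋃ e ∈ idemSet X, maxSubgroup X e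

/-- `H_e/e := {x : xe = ex ∈ H_e}`. -/
def HeCoideal (e : X) : Set X := {x | x * e = e * x ∧ x * e ∈ maxSubgroup X e}

/-- `I` is an ideal of the semigroup `X`. -/
def IsIdealSet (I : Set X) : Prop := ∀ x ∈ I, ∀ y : X, x * y ∈ I ∧ y * x ∈ I

/-- The set `VE(X)` of viable idempotents: `e` is idempotent and `X ∖ (H_e/e)` is an ideal. -/
def viableIdems : Set X := {e | e ∈ idemSet X ∧ IsIdealSet X (Set.univ \ HeCoideal X e)}

/-- The center `Z(X)`. -/
def centerSet : Set X := {z | ∀ x, z * x = x * z}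

/-- `√A = {x : xⁿ ∈ A for some n ≥ 1}`. -/
def sqrtSet (A : Set X) : Set X := {x | ∃ n : ℕ, spow x n ∈ A}

/-- A subset `B ⊆ X` is bounded: there is `n ≥ 1` with `xⁿ` idempotent for all `x ∈ B`. -/
def BoundedSet (B : Set X) : Prop := ∃ n : ℕ, ∀ x ∈ B, spow x n ∈ idemSet X

/-- The semigroup `X` is bounded. -/
def BoundedSemigroup : Prop := ∃ n : ℕ, ∀ x : X, spow x n ∈ idemSet X

/-- `X` is chain-finite. -/
def ChainFinite : Prop :=
  ∀ I : Set X, I.Infinite → ∃ x ∈ I, ∃ y ∈ I, x * y ≠ x ∧ x * y ≠ y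

/-- `G ⊆ X` is a subgroup of the semigroup `X`. -/
def IsSubgroupSet (G : Set X) : Prop :=
  (∀ x ∈ G, ∀ y ∈ G, x * y ∈ G) ∧
    ∃ e ∈ G, (∀ x ∈ G, x * e = x ∧ e * x = x) ∧ ∀ x ∈ G, ∃ y ∈ G, x * y = e ∧ y * x = e

/-- `X` is group-finite: all its subgroups are finite. -/
def GroupFinite : Prop := ∀ G : Set X, IsSubgroupSet X G → G.Finite

/-- `X` is Clifford+finite: `X ∖ H(X)` is finite. -/
def CliffordPlusFinite : Prop := (Set.univ \ cliffordPart X).Finite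

/-- `X` is `E`-commutative: idempotents commute. -/
def ECommutative : Prop := ∀ x ∈ idemSet X, ∀ y ∈ idemSet X, x * y = y * x

end AlgDefs

/-- The Rees congruence associated with an ideal `I` of `X`. -/
def ReesCon {X : Type*} [Semigroup X] (I : Set X) (hI : IsIdealSet X I) : Con X where
  r x y := x = y ∨ (x ∈ I ∧ y ∈ I)
  iseqv :=
    { refl := fun _ => Or.inl rfl
      symm := by rintro x y (rfl | ⟨h1, h2⟩); exacts [Or.inl rfl, Or.inr ⟨h2, h1⟩]
      trans := by
        rintro x y z (rfl | ⟨h1, h2⟩) (rfl | ⟨h3, h4⟩)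
        exacts [Or.inl rfl, Or.inr ⟨h3, h4⟩, Or.inr ⟨h1, h2⟩, Or.inr ⟨h1, h4⟩] }
  mul' := by
    rintro a b c d (rfl | ⟨h1, h2⟩) (rfl | ⟨h3, h4⟩)
    · exact Or.inl rfl
    · exact Or.inr ⟨(hI c h3 a).2, (hI d h4 a).2⟩
    · exact Or.inr ⟨(hI a h1 c).1, (hI b h2 c).1⟩
    · exact Or.inr ⟨(hI a h1 c).1, (hI b h2 d).1⟩

/-- `X` is ideally `T₂S`-closed: all its Rees quotients are `T₂S`-closed. -/
def IdeallyT2SClosed (X : Type u) [Semigroup X] : Prop :=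
  ∀ (I : Set X) (hI : IsIdealSet X I), T2SClosed (ReesCon I hI).Quotient

/-- `X` is ideally `TzS`-closed. -/
def IdeallyTzSClosed (X : Type u) [Semigroup X] : Prop :=
  ∀ (I : Set X) (hI : IsIdealSet X I), TzSClosed (ReesCon I hI).Quotient

/-- A congruence is a semilattice congruence if its quotient is a commutative
semigroup of idempotents. -/
def IsSemilatticeCon {X : Type*} [Semigroup X] (c : Con X) : Prop :=
  (∀ a b : c.Quotient, a * b = b * a) ∧ ∀ a : c.Quotient, a * a = a

/-- The smallest semilattice congruence `⇕` on `X`, the intersection of all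
semilattice congruences. -/
def slCon (X : Type*) [Semigroup X] : Con X := sInf {c | IsSemilatticeCon c}

theorem centerSet_mul_mem {X : Type*} [Semigroup X] {a b : X}
    (ha : a ∈ centerSet X) (hb : b ∈ centerSet X) : a * b ∈ centerSet X := fun t => by
  rw [mul_assoc, hb t, ← mul_assoc, ha t, mul_assoc]

/-- The ideal center `IZ(X) = {z ∈ Z(X) : zX ⊆ Z(X)}`, as a subsemigroup of `X`. -/
def idealCenter (X : Type*) [Semigroup X] : Subsemigroup X where
  carrier := {z | z ∈ centerSet X ∧ ∀ x : X, z * x ∈ centerSet X}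
  mul_mem' := by
    rintro a b ⟨ha, ha'⟩ ⟨hb, hb'⟩
    refine ⟨centerSet_mul_mem ha hb, fun x => ?_⟩
    have h : a * b * x = a * (b * x) := mul_assoc a b x
    rw [h]
    exact centerSet_mul_mem ha (hb' x)

/-- Evaluation of the semigroup polynomial with coefficients `a, l = [a₁, …, aₙ]`:
`x ↦ a * x * a₁ * x * ⋯ * x * aₙ` (computed in `X¹ = WithOne X`). -/
def polyEval {X : Type*} [Semigroup X] (a : WithOne X) (l : List (WithOne X)) (x : X) :
    WithOne X :=
  l.foldl (fun acc b => acc * (x : WithOne X) * b) a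

/-- `f : X → X¹` is a semigroup polynomial of degree `d ≥ 1`. -/
def IsSemigroupPolynomial {X : Type*} [Semigroup X] (f : X → WithOne X) (d : ℕ) : Prop :=
  1 ≤ d ∧ ∃ (a : WithOne X) (l : List (WithOne X)), l.length = d ∧ ∀ x, f x = polyEval a l x

/-- `X` is polybounded. -/
def Polybounded (X : Type*) [Semigroup X] : Prop :=
  ∃ (k : ℕ) (f : Fin k → X → WithOne X) (d : Fin k → ℕ) (b : Fin k → X),
    (∀ i, IsSemigroupPolynomial (f i) (d i)) ∧ ∀ x : X, ∃ i, f i x = (b i : WithOne X)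

/-- `X` is polyfinite. -/
def Polyfinite (X : Type*) [Semigroup X] : Prop :=
  ∃ (d : ℕ) (F : Set X), F.Finite ∧ ∀ x y : X,
    ∃ (f : X → WithOne X) (m : ℕ), m ≤ d ∧ IsSemigroupPolynomial f m ∧
      (∃ u ∈ F, f x = (u : WithOne X)) ∧ ∃ v ∈ F, f y = (v : WithOne X)

/-- `X` is `B`-centrobounded over `B ⊆ E(X)`: there is `n ≥ 1` such that for every
`e ∈ B` and all `x, y ∈ ⋂_{a ∈ B} H_a/a`, if `w` is the inverse of `y*e` in the group
`H_e` and `(x*e)*w ∈ H_e ∩ Z(X)`, then `((x*e)*w)ⁿ` is an idempotent. -/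
def Centrobounded {X : Type*} [Semigroup X] (B : Set X) : Prop :=
  ∃ n : ℕ, ∀ e ∈ B, ∀ x ∈ ⋂ a ∈ B, HeCoideal X a, ∀ y ∈ ⋂ a ∈ B, HeCoideal X a,
    ∀ w ∈ maxSubgroup X e, (y * e) * w = e → w * (y * e) = e →
      (x * e) * w ∈ maxSubgroup X e → (x * e) * w ∈ centerSet X →
        spow ((x * e) * w) n ∈ idemSet X

/-- `B` is an antichain in the natural partial order `e ≤ f ⇔ ef = fe = e` on idempotents. -/
def IsIdemAntichain {X : Type*} [Semigroup X] (B : Set X) : Prop :=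
  ∀ e ∈ B, ∀ f ∈ B, e ≠ f → ¬(e * f = e ∧ f * e = e) ∧ ¬(e * f = f ∧ f * e = f)

open Filter Topology Pointwise

/-! ### Zero-dimensional spaces -/

theorem HasClopenBasis.of_nhds {Y : Type*} [TopologicalSpace Y]
    (h : ∀ a : Y, ∀ U ∈ 𝓝 a, ∃ V, IsClopen V ∧ a ∈ V ∧ V ⊆ U) : HasClopenBasis Y :=
  ⟨{s | IsClopen s}, fun _ hs => hs, isTopologicalBasis_of_isOpen_of_nhds (fun _ hs => hs.2)
    fun a U ha hU => by
      obtain ⟨V, hV, haV, hVU⟩ := h a U (hU.mem_nhds ha)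
      exact ⟨V, hV, haV, hVU⟩⟩

theorem HasClopenBasis.exists_isClopen {Y : Type*} [TopologicalSpace Y] (h : HasClopenBasis Y)
    {a : Y} {U : Set Y} (hU : U ∈ 𝓝 a) : ∃ V, IsClopen V ∧ a ∈ V ∧ V ⊆ U := by
  obtain ⟨B, hB, hb⟩ := h
  obtain ⟨V, hV, haV, hVU⟩ := hb.mem_nhds_iff.1 hU
  exact ⟨V, hB V hV, haV, hVU⟩

theorem HasClopenBasis.t2Space {Y : Type*} [TopologicalSpace Y] [T1Space Y]
    (h : HasClopenBasis Y) : T2Space Y := by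
  refine ⟨fun x y hxy => ?_⟩
  obtain ⟨V, hV, hx, hVU⟩ := h.exists_isClopen (isOpen_compl_singleton.mem_nhds hxy)
  exact ⟨V, Vᶜ, hV.isOpen, hV.compl.isOpen, hx, fun hy => hVU hy rfl, disjoint_compl_right⟩

theorem HasClopenBasis.of_isInducing {Y Z : Type*} [TopologicalSpace Y] [TopologicalSpace Z]
    (h : HasClopenBasis Z) {f : Y → Z} (hf : IsInducing f) : HasClopenBasis Y := by
  refine .of_nhds fun a U hU => ?_
  rw [hf.nhds_eq_comap] at hU
  obtain ⟨W, hW, hWU⟩ := hU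
  obtain ⟨V, hV, haV, hVW⟩ := h.exists_isClopen hW
  exact ⟨f ⁻¹' V, hV.preimage hf.continuous, haV, (preimage_mono hVW).trans hWU⟩

theorem HasClopenBasis.pi_of_discreteTopology {ι : Type*} (Y : ι → Type*)
    [∀ i, TopologicalSpace (Y i)] [∀ i, DiscreteTopology (Y i)] :
    HasClopenBasis (∀ i, Y i) := by
  refine .of_nhds fun a U hU => ?_
  rw [nhds_pi, Filter.mem_pi] at hU
  obtain ⟨I, hI, t, ht, hU⟩ := hU
  refine ⟨I.pi fun i => {a i}, ⟨isClosed_set_pi fun i _ => isClosed_discrete _,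
    isOpen_set_pi hI fun i _ => isOpen_discrete _⟩, fun i _ => rfl, fun f hf => hU fun i hi => ?_⟩
  rw [show f i = a i from hf i hi]
  exact mem_of_mem_nhds (ht i)

theorem HasClopenBasis.of_countable (Y : Type*) [MetricSpace Y] [Countable Y] :
    HasClopenBasis Y := by
  refine .of_nhds fun a U hU => ?_
  obtain ⟨ε, hε, hεU⟩ := Metric.mem_nhds_iff.1 hU
  have hc : (range fun y : Y => dist y a).Countable := countable_range _
  obtain ⟨r, hr, hrr⟩ : (Ioo 0 ε \ range fun y : Y => dist y a).Nonempty := by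
    rw [nonempty_iff_ne_empty, Ne, sdiff_eq_empty]
    intro hs
    exact (Cardinal.Real.Ioo_countable_iff.1 (hc.mono hs)).not_gt hε
  refine ⟨Metric.ball a r, ⟨?_, Metric.isOpen_ball⟩, Metric.mem_ball_self hr.1,
    (Metric.ball_subset_ball hr.2.le).trans hεU⟩
  have : Metric.ball a r = Metric.closedBall a r := by
    ext y
    simp only [Metric.mem_ball, Metric.mem_closedBall]
    exact ⟨le_of_lt, fun h => lt_of_le_of_ne h fun h' => hrr ⟨y, h'⟩⟩
  rw [this]
  exact Metric.isClosed_closedBall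

/-! ### Closedness notions -/

/-- `X` is injectively `TzS`-closed. -/
def InjectivelyTzSClosed (X : Type u) [Semigroup X] : Prop :=
  ∀ (Y : Type u) [Semigroup Y] [TopologicalSpace Y] [ContinuousMul Y] [T1Space Y],
    HasClopenBasis Y → ∀ (h : X →ₙ* Y), Function.Injective h → IsClosed (Set.range h)

section Implications

variable {X : Type u} [Semigroup X]

theorem AbsolutelyT2SClosed.absolutelyTzSClosed (h : AbsolutelyT2SClosed X) :
    AbsolutelyTzSClosed X := by
  intro Y _ _ _ _ hb f
  have := hb.t2Space
  exact h Y f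

theorem AbsolutelyT2SClosed.injectivelyT2SClosed (h : AbsolutelyT2SClosed X) :
    InjectivelyT2SClosed X := by
  intro Y _ _ _ _ f _
  exact h Y f

theorem AbsolutelyT2SClosed.ideallyT2SClosed (h : AbsolutelyT2SClosed X) :
    IdeallyT2SClosed X := by
  intro I hI Y _ _ _ _ f _ _
  let q : X →ₙ* (ReesCon I hI).Quotient := ⟨fun x => (x : (ReesCon I hI).Quotient), fun _ _ => rfl⟩
  have hq : Function.Surjective q := Quotient.mk_surjective
  have := h Y (f.comp q)
  rwa [MulHom.coe_comp, hq.range_comp] at this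

theorem IdeallyT2SClosed.ideallyTzSClosed (h : IdeallyT2SClosed X) : IdeallyTzSClosed X := by
  intro I hI Y _ _ _ _ hb f
  have := hb.t2Space
  exact h I hI Y f

theorem InjectivelyT2SClosed.injectivelyTzSClosed (h : InjectivelyT2SClosed X) :
    InjectivelyTzSClosed X := by
  intro Y _ _ _ _ hb f
  have := hb.t2Space
  exact h Y f

theorem AbsolutelyTzSClosed.injectivelyTzSClosed (h : AbsolutelyTzSClosed X) :
    InjectivelyTzSClosed X := by
  intro Y _ _ _ _ hb f _
  exact h Y hb f

theorem AbsolutelyTzSClosed.ideallyTzSClosed (h : AbsolutelyTzSClosed X) :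
    IdeallyTzSClosed X := by
  intro I hI Y _ _ _ _ hb f _ _
  let q : X →ₙ* (ReesCon I hI).Quotient := ⟨fun x => (x : (ReesCon I hI).Quotient), fun _ _ => rfl⟩
  have hq : Function.Surjective q := Quotient.mk_surjective
  have := h Y hb (f.comp q)
  rwa [MulHom.coe_comp, hq.range_comp] at this

theorem IdeallyTzSClosed.tzSClosed (h : IdeallyTzSClosed X) : TzSClosed X := by
  have hI : IsIdealSet X ∅ := fun x hx => hx.elim
  intro Y _ _ _ _ hb f hf hd
  have hex : ∀ a b : X, ReesCon ∅ hI a b → f a = f b := by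
    rintro a b (rfl | ⟨h, -⟩)
    exacts [rfl, h.elim]
  let g : (ReesCon ∅ hI).Quotient →ₙ* Y :=
    ⟨fun a => Con.liftOn a f hex, by rintro ⟨a⟩ ⟨b⟩; exact map_mul f a b⟩
  have hr : range g = range f := by
    ext y
    constructor
    · rintro ⟨⟨a⟩, rfl⟩; exact ⟨a, rfl⟩
    · rintro ⟨a, rfl⟩; exact ⟨(a : (ReesCon ∅ hI).Quotient), rfl⟩
  have hg : Function.Injective g := by
    rintro ⟨a⟩ ⟨b⟩ hab
    exact congrArg _ (hf hab)
  have := h ∅ hI Y hb g hg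
  rw [hr] at this
  exact this hd

/-- The universe of the target can be lowered to `0`. -/
theorem AbsolutelyTzSClosed.isClosed_range (h : AbsolutelyTzSClosed X) (Y : Type) [Semigroup Y]
    [TopologicalSpace Y] [ContinuousMul Y] [T1Space Y] (hb : HasClopenBasis Y) (f : X →ₙ* Y) :
    IsClosed (range f) := by
  have hb' : HasClopenBasis (ULift.{u} Y) := hb.of_isInducing IsEmbedding.uliftDown.isInducing
  let g : X →ₙ* ULift.{u} Y := ⟨fun x => ⟨f x⟩, fun a b => by
    ext; exact map_mul f a b⟩
  have := (h _ hb' g).preimage continuous_uliftUp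
  convert this using 1
  ext y
  constructor
  · rintro ⟨x, rfl⟩; exact ⟨x, rfl⟩
  · rintro ⟨x, hx⟩; exact ⟨x, congrArg ULift.down hx⟩

/-- A family of congruences which separates points satisfies a compactness principle in
injectively `TzS`-closed semigroups. -/
theorem InjectivelyTzSClosed.exists_forall_con (h : InjectivelyTzSClosed X) {ι : Type u}
    (c : ι → Con X) (hc : ∀ x y, (∀ i, c i x y) → x = y) (t : ι → X)
    (ht : ∀ F : Set ι, F.Finite → ∃ x, ∀ i ∈ F, c i x (t i)) : ∃ x, ∀ i, c i x (t i) := by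
  let : ∀ i, TopologicalSpace (c i).Quotient := fun i => ⊥
  have : ∀ i, DiscreteTopology (c i).Quotient := fun i => ⟨rfl⟩
  let f : X →ₙ* ∀ i, (c i).Quotient := ⟨fun x i => (x : (c i).Quotient), fun _ _ => rfl⟩
  have hf : Function.Injective f := fun x y hxy => hc x y fun i => (c i).eq.1 (congrFun hxy i)
  have hcl := h _ (HasClopenBasis.pi_of_discreteTopology fun i => (c i).Quotient) f hf
  have : (fun i => (t i : (c i).Quotient)) ∈ range f := by
    rw [← hcl.closure_eq, mem_closure_iff_nhds]
    intro U hU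
    rw [nhds_pi, Filter.mem_pi] at hU
    obtain ⟨I, hI, s, hs, hU⟩ := hU
    obtain ⟨x, hx⟩ := ht I hI
    refine ⟨f x, hU fun i hi => ?_, x, rfl⟩
    have : f x i = (t i : (c i).Quotient) := (c i).eq.2 (hx i hi)
    rw [this]
    exact mem_of_mem_nhds (hs i)
  obtain ⟨x, hx⟩ := this
  exact ⟨x, fun i => (c i).eq.1 (congrFun hx i)⟩

/-- A sequence of congruences satisfies a compactness principle in absolutely `TzS`-closed
semigroups. -/
theorem AbsolutelyTzSClosed.exists_forall_con (h : AbsolutelyTzSClosed X)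
    (c : ℕ → Con X) (t : ℕ → X)
    (ht : ∀ n, ∃ x, ∀ i ≤ n, c i x (t i)) : ∃ x, ∀ i, c i x (t i) := by
  let : ∀ i, TopologicalSpace (c i).Quotient := fun i => ⊥
  have : ∀ i, DiscreteTopology (c i).Quotient := fun i => ⟨rfl⟩
  let f : X →ₙ* ∀ i, (c i).Quotient := ⟨fun x i => (x : (c i).Quotient), fun _ _ => rfl⟩
  have hcl := h _ (HasClopenBasis.pi_of_discreteTopology fun i => (c i).Quotient) f
  have : (fun i => (t i : (c i).Quotient)) ∈ range f := by
    rw [← hcl.closure_eq, mem_closure_iff_nhds]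
    intro U hU
    rw [nhds_pi, Filter.mem_pi] at hU
    obtain ⟨I, hI, s, hs, hU⟩ := hU
    obtain ⟨n, hn⟩ := hI.bddAbove
    obtain ⟨x, hx⟩ := ht n
    refine ⟨f x, hU fun i hi => ?_, x, rfl⟩
    have : f x i = (t i : (c i).Quotient) := (c i).eq.2 (hx i (hn hi))
    rw [this]
    exact mem_of_mem_nhds (hs i)
  obtain ⟨x, hx⟩ := this
  exact ⟨x, fun i => (c i).eq.1 (congrFun hx i)⟩

end Implications

/-! ### Powers in semigroups -/

theorem coe_spow {X : Type*} [Semigroup X] (x : X) (n : ℕ) :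
    ((spow x n : X) : WithOne X) = (x : WithOne X) ^ (n + 1) := by
  induction n with
  | zero => simp [spow]
  | succ n ih => rw [spow, WithOne.coe_mul, ih, pow_succ _ (n + 1)]

theorem spow_mul_spow {X : Type*} [Semigroup X] (x : X) (m n : ℕ) :
    spow x m * spow x n = spow x (m + n + 1) := by
  apply WithOne.coe_injective
  rw [WithOne.coe_mul, coe_spow, coe_spow, coe_spow, ← pow_add]
  congr 1
  lia

theorem spow_spow {X : Type*} [Semigroup X] (x : X) (m n : ℕ) :
    spow (spow x m) n = spow x (m * n + m + n) := by
  apply WithOne.coe_injective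
  rw [coe_spow, coe_spow, coe_spow, ← pow_mul]
  congr 1
  lia

theorem mul_spow {X : Type*} [CommSemigroup X] (x y : X) (n : ℕ) :
    spow (x * y) n = spow x n * spow y n := by
  induction n with
  | zero => rfl
  | succ n ih => rw [spow, spow, spow, ih, mul_mul_mul_comm]

theorem map_spow {X Y : Type*} [Semigroup X] [Semigroup Y] (f : X →ₙ* Y) (x : X) (n : ℕ) :
    f (spow x n) = spow (f x) n := by
  induction n with
  | zero => rfl
  | succ n ih => rw [spow, spow, map_mul, ih]

theorem spow_of_mul_self {X : Type*} [Semigroup X] {e : X} (he : e * e = e) (n : ℕ) :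
    spow e n = e := by
  induction n with
  | zero => rfl
  | succ n ih => rw [spow, ih, he]

theorem spow_mul_of_mul_eq {X : Type*} [Semigroup X] {x e : X} (h : x * e = x) (n : ℕ) :
    spow x n * e = spow x n := by
  cases n with
  | zero => exact h
  | succ n => rw [spow, mul_assoc, h]

theorem continuous_spow {Y : Type*} [Semigroup Y] [TopologicalSpace Y] [ContinuousMul Y] (n : ℕ) :
    Continuous fun y : Y => spow y n := by
  induction n with
  | zero => exact continuous_id
  | succ n ih => exact ih.mul continuous_id

/-! ### Periodic semigroups -/

/-- Every element has an idempotent power. -/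
def IsPeriodic (X : Type*) [Semigroup X] : Prop := ∀ x : X, ∃ n, spow x n ∈ idemSet X

theorem BoundedSemigroup.isPeriodic {X : Type*} [Semigroup X] (h : BoundedSemigroup X) :
    IsPeriodic X := fun x => h.imp fun _ hn => hn x

namespace IsPeriodic

variable {X : Type*} [CommSemigroup X] (hp : IsPeriodic X)

/-- The unique idempotent power of `x`. -/
noncomputable def idem (x : X) : X := spow x (hp x).choose

theorem exists_spow_eq_idem (x : X) : ∃ n, spow x n = hp.idem x := ⟨_, rfl⟩

theorem idem_mul_self (x : X) : hp.idem x * hp.idem x = hp.idem x := (hp x).choose_spec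

theorem idem_mem (x : X) : hp.idem x ∈ idemSet X := (hp x).choose_spec

theorem spow_eq_idem {x : X} {n : ℕ} (h : spow x n ∈ idemSet X) : spow x n = hp.idem x := by
  obtain ⟨m, hm⟩ := hp.exists_spow_eq_idem x
  calc spow x n = spow (spow x n) m := (spow_of_mul_self h m).symm
    _ = spow (spow x m) n := by rw [spow_spow, spow_spow]; congr 1; ring
    _ = hp.idem x := by rw [hm, spow_of_mul_self (hp.idem_mul_self x)]

theorem idem_eq_of_mul_self {e : X} (he : e * e = e) : hp.idem e = e :=
  (hp.spow_eq_idem (n := 0) he).symm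

theorem idem_mul (x y : X) : hp.idem (x * y) = hp.idem x * hp.idem y := by
  obtain ⟨m, hm⟩ := hp.exists_spow_eq_idem x
  obtain ⟨n, hn⟩ := hp.exists_spow_eq_idem y
  have h : spow (x * y) (m * n + m + n) = hp.idem x * hp.idem y := by
    rw [mul_spow, ← spow_spow x, hm, spow_of_mul_self (hp.idem_mul_self x),
      show m * n + m + n = n * m + n + m by ring, ← spow_spow y, hn,
      spow_of_mul_self (hp.idem_mul_self y)]
  rw [← h, hp.spow_eq_idem]
  change _ * _ = _
  rw [h, mul_mul_mul_comm, idem_mul_self, idem_mul_self]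

theorem idem_spow (x : X) (n : ℕ) : hp.idem (spow x n) = hp.idem x := by
  induction n with
  | zero => rfl
  | succ n ih => rw [spow, idem_mul, ih, idem_mul_self]

theorem mem_maxSubgroup_iff {e x : X} (he : e * e = e) :
    x ∈ maxSubgroup X e ↔ hp.idem x = e ∧ e * x = x := by
  obtain ⟨n, hn⟩ := hp.exists_spow_eq_idem x
  constructor
  · rintro ⟨h1, h2, y, h3, h4, h5, h6⟩
    refine ⟨?_, h2⟩
    have h7 : hp.idem x * spow y n = e := by
      rw [← hn, ← mul_spow, h5, spow_of_mul_self he]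
    calc hp.idem x = hp.idem x * e := by rw [← hn, spow_mul_of_mul_eq h1]
      _ = hp.idem x * hp.idem x * spow y n := by rw [mul_assoc, h7]
      _ = e := by rw [idem_mul_self, h7]
  · rintro ⟨h1, h2⟩
    have h3 : x * e = x := by rw [mul_comm, h2]
    have h4 : x * spow x (2 * n) = e := by
      change spow x 0 * _ = _
      rw [spow_mul_spow, show 0 + 2 * n + 1 = n + n + 1 by ring, ← spow_mul_spow, hn,
        idem_mul_self, h1]
    have h5 := spow_mul_of_mul_eq h3 (2 * n)
    exact ⟨h3, h2, spow x (2 * n), h5, by rw [mul_comm, h5], h4, by rw [mul_comm, h4]⟩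

theorem mem_cliffordPart_iff {x : X} : x ∈ cliffordPart X ↔ hp.idem x * x = x := by
  simp only [cliffordPart, mem_iUnion, exists_prop]
  constructor
  · rintro ⟨e, he, hx⟩
    obtain ⟨h1, h2⟩ := (hp.mem_maxSubgroup_iff he).1 hx
    rwa [h1]
  · intro h
    exact ⟨hp.idem x, hp.idem_mem x, (hp.mem_maxSubgroup_iff (hp.idem_mem x)).2 ⟨rfl, h⟩⟩

theorem mul_mem_maxSubgroup_iff {e x : X} (he : e * e = e) :
    x * e ∈ maxSubgroup X e ↔ hp.idem x * e = e := by
  rw [hp.mem_maxSubgroup_iff he, idem_mul, hp.idem_eq_of_mul_self he, mul_left_comm, he]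
  simp

end IsPeriodic

/-! ### Maximal subgroups -/

section MaxSubgroup

variable {X : Type*} [CommSemigroup X] {e : X}

theorem mul_mem_maxSubgroup {x y : X} (hx : x ∈ maxSubgroup X e)
    (hy : y ∈ maxSubgroup X e) : x * y ∈ maxSubgroup X e := by
  obtain ⟨h1, h2, z, h3, h4, h5, h6⟩ := hx
  obtain ⟨k1, k2, w, k3, k4, k5, k6⟩ := hy
  have h7 : x * y * (z * w) = e := by
    rw [mul_mul_mul_comm, h5, k5]
    calc e * e = e * (x * z) := by rw [h5]
      _ = e := by rw [← mul_assoc, h2, h5]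
  exact ⟨by rw [mul_assoc, k1], by rw [← mul_assoc, h2], z * w, by rw [mul_assoc, k3],
    by rw [← mul_assoc, h4], h7, by rw [mul_comm, h7]⟩

theorem self_mem_maxSubgroup (he : e * e = e) : e ∈ maxSubgroup X e :=
  ⟨he, he, e, he, he, he, he⟩

theorem isSubgroupSet_maxSubgroup (he : e * e = e) : IsSubgroupSet X (maxSubgroup X e) :=
  ⟨fun _ hx _ hy => mul_mem_maxSubgroup hx hy, e, self_mem_maxSubgroup he,
    fun _ hx => ⟨hx.1, hx.2.1⟩, fun x hx => by
      obtain ⟨h1, h2, z, h3, h4, h5, h6⟩ := hx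
      exact ⟨z, ⟨h3, h4, x, h1, h2, h6, h5⟩, h5, h6⟩⟩

theorem IsSubgroupSet.exists_subset_maxSubgroup {G : Set X} (hG : IsSubgroupSet X G) :
    ∃ e, e * e = e ∧ G ⊆ maxSubgroup X e := by
  obtain ⟨-, e, he, h1, h2⟩ := hG
  refine ⟨e, (h1 e he).1, fun x hx => ?_⟩
  obtain ⟨y, hy, h3, h4⟩ := h2 x hx
  exact ⟨(h1 x hx).1, (h1 x hx).2, y, (h1 y hy).1, (h1 y hy).2, h3, h4⟩

theorem exists_mul_eq_of_maxSubgroup (x : maxSubgroup X e) :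
    ∃ y : maxSubgroup X e, (y : X) * x = e := by
  obtain ⟨x, h1, h2, z, h3, h4, h5, h6⟩ := x
  exact ⟨⟨z, h3, h4, x, h1, h2, h6, h5⟩, h6⟩

/-- The group structure of the maximal subgroup at an idempotent. -/
noncomputable abbrev maxSubgroupCommGroup (he : e * e = e) : CommGroup (maxSubgroup X e) where
  mul x y := ⟨x * y, mul_mem_maxSubgroup x.2 y.2⟩
  mul_assoc x y z := Subtype.ext (mul_assoc _ _ _)
  mul_comm x y := Subtype.ext (mul_comm _ _)
  one := ⟨e, self_mem_maxSubgroup he⟩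
  one_mul x := Subtype.ext x.2.2.1
  mul_one x := Subtype.ext x.2.1
  inv x := (exists_mul_eq_of_maxSubgroup x).choose
  inv_mul_cancel x := Subtype.ext (exists_mul_eq_of_maxSubgroup x).choose_spec

end MaxSubgroup

/-! ### Semigroups of ultrafilters -/

theorem continuousMul_filter (X : Type*) [Semigroup X] : ContinuousMul (Filter X) := by
  refine ⟨continuous_iff_continuousAt.2 fun ⟨l, m⟩ => ?_⟩
  intro U hU
  rw [mem_map]
  obtain ⟨s, hs, hU⟩ := Filter.mem_nhds_iff'.1 hU
  obtain ⟨t₁, h₁, t₂, h₂, hs⟩ := Filter.mem_mul.1 hs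
  filter_upwards [(Filter.isOpen_setOfPred_mem (s := t₁)).preimage continuous_fst |>.mem_nhds h₁,
    (Filter.isOpen_setOfPred_mem (s := t₂)).preimage continuous_snd |>.mem_nhds h₂] with p hp₁ hp₂
  exact hU (Filter.mem_of_superset (Filter.mul_mem_mul hp₁ hp₂) hs)

theorem TzSClosed.exists_eq_pure {X : Type u} [Semigroup X] (h : TzSClosed X)
    (S : Subsemigroup (Filter X)) (hS : ∀ l ∈ S, ∃ u : Ultrafilter X, (u : Filter X) = l)
    (hpure : ∀ x, pure x ∈ S) {l : Filter X} (hl : l ∈ S) : ∃ x, l = pure x := by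
  have := continuousMul_filter X
  have hopen (t : Set X) : IsOpen {a : S | t ∈ (a : Filter X)} :=
    Filter.isOpen_setOfPred_mem.preimage continuous_subtype_val
  have hclopen (t : Set X) : IsClopen {a : S | t ∈ (a : Filter X)} := by
    refine ⟨⟨?_⟩, hopen t⟩
    convert hopen tᶜ using 1
    ext ⟨a, ha⟩
    obtain ⟨u, rfl⟩ := hS a ha
    exact Ultrafilter.compl_mem_iff_notMem.symm
  have hnhds (a : S) (U : Set S) (hU : U ∈ 𝓝 a) :
      ∃ t ∈ (a : Filter X), {b : S | t ∈ (b : Filter X)} ⊆ U := by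
    rw [nhds_subtype_eq_comap] at hU
    obtain ⟨W, hW, hWU⟩ := hU
    obtain ⟨t, ht, htW⟩ := Filter.mem_nhds_iff'.1 hW
    exact ⟨t, ht, fun b hb => hWU (htW hb)⟩
  have hbasis : HasClopenBasis S := .of_nhds fun a U hU => by
    obtain ⟨t, ht, htU⟩ := hnhds a U hU
    exact ⟨_, hclopen t, ht, htU⟩
  have : T1Space S := by
    refine t1Space_iff_exists_open.2 fun ⟨a, ha⟩ ⟨b, hb⟩ hab => ?_
    by_contra! hcon
    obtain ⟨u, rfl⟩ := hS a ha
    obtain ⟨v, rfl⟩ := hS b hb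
    have hle : (v : Filter X) ≤ u := fun t ht => hcon _ (hopen t) ht
    exact hab (Subtype.ext (u.unique hle).symm)
  let f : X →ₙ* S := ⟨fun x => ⟨pure x, hpure x⟩, fun x y => Subtype.ext Filter.pure_mul_pure.symm⟩
  have hf : Function.Injective f := fun x y hxy => pure_injective (congrArg Subtype.val hxy)
  have hd : DiscreteTopology (range f) := by
    refine discreteTopology_iff_isOpen_singleton.2 fun ⟨_, x, rfl⟩ => ?_
    convert (hopen {x}).preimage continuous_subtype_val using 1
    ext ⟨_, y, rfl⟩
    constructor
    · intro h
      have : f y = f x := congrArg Subtype.val h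
      rw [hf this]
      exact Filter.mem_pure.2 rfl
    · intro h
      have : y = x := Filter.mem_pure.1 h
      subst this
      rfl
  have hcl := h S hbasis f hf hd
  have : (⟨l, hl⟩ : S) ∈ range f := by
    rw [← hcl.closure_eq, mem_closure_iff_nhds]
    intro U hU
    obtain ⟨t, ht, htU⟩ := hnhds _ U hU
    obtain ⟨u, hu⟩ := hS l hl
    have : (l : Filter X).NeBot := hu ▸ u.neBot
    obtain ⟨x, hx⟩ := this.nonempty_of_mem ht
    exact ⟨f x, htU (Filter.mem_pure.2 hx), x, rfl⟩
  obtain ⟨x, hx⟩ := this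
  exact ⟨x, (congrArg Subtype.val hx).symm⟩

theorem TzSClosed.ultrafilter_eq_pure {X : Type u} [CommSemigroup X] (h : TzSClosed X)
    (u : Ultrafilter X)
    (hu : (u : Filter X) * u = u ∨ ∃ c, (u : Filter X) * u = pure c) :
    ∃ x, (u : Filter X) = pure x := by
  let S : Subsemigroup (Filter X) :=
    { carrier := {l | (∃ x, l = pure x) ∨ l = u ∨ ∃ x, l = pure x * u}
      mul_mem' := by
        have aux (x : X) : (∃ z, pure x * ((u : Filter X) * u) = pure z) ∨
            pure x * ((u : Filter X) * u) = u ∨ ∃ z, pure x * ((u : Filter X) * u) = pure z * u := by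
          rcases hu with hu | ⟨c, hu⟩
          · exact Or.inr (Or.inr ⟨x, by rw [hu]⟩)
          · exact Or.inl ⟨x * c, by rw [hu, Filter.pure_mul_pure]⟩
        rintro a b (⟨x, rfl⟩ | rfl | ⟨x, rfl⟩) (⟨y, rfl⟩ | rfl | ⟨y, rfl⟩)
        · exact Or.inl ⟨x * y, Filter.pure_mul_pure⟩
        · exact Or.inr (Or.inr ⟨x, rfl⟩)
        · exact Or.inr (Or.inr ⟨x * y, by rw [← mul_assoc, Filter.pure_mul_pure]⟩)
        · exact Or.inr (Or.inr ⟨y, mul_comm _ _⟩)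
        · rcases hu with hu | ⟨c, hu⟩
          · exact Or.inr (Or.inl hu)
          · exact Or.inl ⟨c, hu⟩
        · rw [mul_left_comm]
          exact aux y
        · exact Or.inr (Or.inr ⟨y * x, by rw [mul_comm, ← mul_assoc, Filter.pure_mul_pure]⟩)
        · rw [mul_assoc]
          exact aux x
        · rw [mul_mul_mul_comm, Filter.pure_mul_pure]
          exact aux (x * y) }
  refine h.exists_eq_pure S ?_ (fun x => Or.inl ⟨x, rfl⟩) (Or.inr (Or.inl rfl))
  rintro l (⟨x, rfl⟩ | rfl | ⟨x, rfl⟩)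
  · exact ⟨pure x, rfl⟩
  · exact ⟨u, rfl⟩
  · exact ⟨u.map (x * ·), by rw [Filter.pure_mul]; rfl⟩

theorem exists_ultrafilter_mem_of_infinite {X : Type*} {A : Set X} (hA : A.Infinite) :
    ∃ u : Ultrafilter X, A ∈ u ∧ ∀ x, (u : Filter X) ≠ pure x := by
  have := hA.cofinite_inf_principal_neBot
  have hle := Ultrafilter.of_le (cofinite ⊓ 𝓟 A)
  refine ⟨Ultrafilter.of (cofinite ⊓ 𝓟 A), hle (mem_inf_of_right (mem_principal_self A)),
    fun x hx => ?_⟩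
  have h1 : ({x}ᶜ : Set X) ∈ Ultrafilter.of (cofinite ⊓ 𝓟 A) :=
    hle (mem_inf_of_left (finite_singleton x).compl_mem_cofinite)
  rw [← Ultrafilter.mem_coe, hx] at h1
  exact Filter.mem_pure.1 h1 rfl

theorem TzSClosed.chainFinite {X : Type u} [CommSemigroup X] (h : TzSClosed X) :
    ChainFinite X := by
  intro I hI
  by_contra! hcon
  obtain ⟨u, hIu, hu⟩ := exists_ultrafilter_mem_of_infinite hI
  have hle : (u : Filter X) * u ≤ u := by
    intro C hC
    have hCI : C ∩ I ∈ (u : Filter X) := inter_mem hC hIu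
    refine mem_of_superset (Filter.mul_mem_mul hCI hCI) ?_
    rintro _ ⟨x, hx, y, hy, rfl⟩
    change x * y ∈ C
    by_cases hxy : x * y = x
    · rw [hxy]
      exact hx.1
    · rw [hcon x hx.2 y hy.2 hxy]
      exact hy.1
  obtain ⟨x, hx⟩ := h.ultrafilter_eq_pure u (Or.inl (u.unique hle))
  exact hu x hx

/-- An ideally `TzS`-closed semigroup has no infinite null subsets modulo an ideal. -/
theorem IdeallyTzSClosed.finite_of_mul_mem {X : Type u} [CommSemigroup X]
    (h : IdeallyTzSClosed X) {I : Set X} (hI : IsIdealSet X I) {A : Set X}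
    (hAI : ∀ a ∈ A, a ∉ I) (hA : ∀ a ∈ A, ∀ b ∈ A, a * b ∈ I) : A.Finite := by
  by_contra hinf
  have hinf : A.Infinite := hinf
  obtain ⟨a, ha⟩ := hinf.nonempty
  let q : X → (ReesCon I hI).Quotient := fun x => x
  have hq : InjOn q A := by
    intro x hx y hy hxy
    rcases (ReesCon I hI).eq.1 hxy with h | ⟨h, -⟩
    exacts [h, (hAI x hx h).elim]
  obtain ⟨u, hAu, hu⟩ := exists_ultrafilter_mem_of_infinite (hinf.image hq)
  have hle : (u : Filter (ReesCon I hI).Quotient) * u ≤ (pure (q (a * a)) : Ultrafilter _) := by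
    intro C hC
    refine mem_of_superset (Filter.mul_mem_mul hAu hAu) ?_
    rintro _ ⟨_, ⟨x, hx, rfl⟩, _, ⟨y, hy, rfl⟩, rfl⟩
    have : q (x * y) = q (a * a) := (ReesCon I hI).eq.2 (Or.inr ⟨hA x hx y hy, hA a ha a ha⟩)
    change q (x * y) ∈ C
    rw [this]
    exact Filter.mem_pure.1 hC
  obtain ⟨x, hx⟩ := (h I hI).ultrafilter_eq_pure u (Or.inr ⟨_, Ultrafilter.unique _ hle⟩)
  exact hu x hx

/-! ### Chain-finite semigroups -/

section ChainFinite

variable {X : Type*} [CommSemigroup X]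

theorem ChainFinite.wellFounded (h : ChainFinite X) (r : X → X → Prop) [IsTrans X r]
    [Std.Irrefl r]
    (hr : ∀ a b, r a b → a * a = a ∧ b * b = b ∧ (a * b = a ∨ a * b = b)) : WellFounded r := by
  refine wellFounded_iff_isEmpty_descending_chain.2 ⟨fun ⟨f, hf⟩ => ?_⟩
  have hlt : ∀ m n, m < n → r (f n) (f m) := by
    intro m n hmn
    induction n, hmn using Nat.le_induction with
    | base => exact hf m
    | succ n _ ih => exact _root_.trans (hf n) ih
  have hinj : Function.Injective f := by
    intro m n hmn
    rcases lt_trichotomy m n with h | h | h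
    · exact (irrefl (r := r) (f n) (hmn ▸ hlt m n h)).elim
    · exact h
    · exact (irrefl (r := r) (f n) (hmn ▸ hlt n m h)).elim
  obtain ⟨_, ⟨m, rfl⟩, _, ⟨n, rfl⟩, h1, h2⟩ := h _ (infinite_range_of_injective hinj)
  rcases lt_trichotomy m n with h | rfl | h
  · rw [mul_comm] at h1 h2
    rcases (hr _ _ (hlt m n h)).2.2 with h' | h'
    exacts [h2 h', h1 h']
  · exact h1 (hr _ _ (hf m)).2.1
  · rcases (hr _ _ (hlt n m h)).2.2 with h' | h'
    exacts [h1 h', h2 h']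

theorem ChainFinite.exists_minimal (h : ChainFinite X) {S : Set X} (hS : S.Nonempty)
    (hE : ∀ p ∈ S, p * p = p) : ∃ m ∈ S, ∀ p ∈ S, p * m = p → p = m := by
  let r : X → X → Prop := fun a b => a * a = a ∧ b * b = b ∧ a * b = a ∧ a ≠ b
  have : IsTrans X r := ⟨by
    rintro a b c ⟨h1, h2, h3, h4⟩ ⟨h5, h6, h7, h8⟩
    have hac : a * c = a := by rw [← h3, mul_assoc, h7]
    refine ⟨h1, h6, hac, ?_⟩
    rintro rfl
    exact h8 (by rw [← h7, mul_comm, h3])⟩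
  have : Std.Irrefl r := ⟨fun a ha => ha.2.2.2 rfl⟩
  obtain ⟨m, hm, hmin⟩ := (h.wellFounded r fun a b hab =>
    ⟨hab.1, hab.2.1, Or.inl hab.2.2.1⟩).has_min S hS
  refine ⟨m, hm, fun p hp hpm => ?_⟩
  by_contra hne
  exact hmin p hp ⟨hE p hp, hE m hm, hpm, hne⟩

theorem ChainFinite.exists_maximal (h : ChainFinite X) {S : Set X} (hS : S.Nonempty)
    (hE : ∀ p ∈ S, p * p = p) : ∃ m ∈ S, ∀ p ∈ S, m * p = m → p = m := by
  let r : X → X → Prop := fun a b => a * a = a ∧ b * b = b ∧ a * b = b ∧ a ≠ b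
  have : IsTrans X r := ⟨by
    rintro a b c ⟨h1, h2, h3, h4⟩ ⟨h5, h6, h7, h8⟩
    have hac : a * c = c := by rw [← h7, ← mul_assoc, h3]
    refine ⟨h1, h6, hac, ?_⟩
    rintro rfl
    exact h8 (by rw [← h7, mul_comm, h3])⟩
  have : Std.Irrefl r := ⟨fun a ha => ha.2.2.2 rfl⟩
  obtain ⟨m, hm, hmax⟩ := (h.wellFounded r fun a b hab =>
    ⟨hab.1, hab.2.1, Or.inr hab.2.2.1⟩).has_min S hS
  refine ⟨m, hm, fun p hp hpm => ?_⟩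
  by_contra hne
  exact hmax p hp ⟨hE p hp, hE m hm, by rw [mul_comm, hpm], hne⟩

theorem ChainFinite.exists_strictMono_antichain (h : ChainFinite X) {f : ℕ → X}
    (hf : Function.Injective f) (hE : ∀ n, f n * f n = f n) :
    ∃ g : ℕ → ℕ, StrictMono g ∧ ∀ m n, m ≠ n → f (g m) * f (g n) ≠ f (g m) := by
  have key (g : ℕ → ℕ) (hg : Function.Injective g)
      (hc : ∀ m n, m < n → f (g m) * f (g n) = f (g m) ∨ f (g m) * f (g n) = f (g n)) :
      False := by
    obtain ⟨_, ⟨m, rfl⟩, _, ⟨n, rfl⟩, h1, h2⟩ :=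
      h (range (f ∘ g)) (infinite_range_of_injective (hf.comp hg))
    rcases lt_trichotomy m n with h | rfl | h
    · rcases hc _ _ h with h' | h'
      exacts [h1 h', h2 h']
    · exact h1 (hE _)
    · rw [mul_comm] at h1 h2
      rcases hc _ _ h with h' | h'
      exacts [h2 h', h1 h']
  let r₁ : X → X → Prop := fun a b => a * b = a
  let r₂ : X → X → Prop := fun a b => a * b = b
  have : IsTrans X r₁ := ⟨fun a b c h1 h2 => by
    change a * c = a
    rw [← show a * b = a from h1, mul_assoc, show b * c = b from h2]⟩
  have : IsTrans X r₂ := ⟨fun a b c h1 h2 => by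
    change a * c = c
    rw [← show b * c = c from h2, ← mul_assoc, show a * b = b from h1]⟩
  obtain ⟨g, hg⟩ := exists_increasing_or_nonincreasing_subseq r₁ f
  rcases hg with hg | hg
  · exact (key g g.injective fun m n hmn => Or.inl (hg m n hmn)).elim
  obtain ⟨k, hk⟩ := exists_increasing_or_nonincreasing_subseq r₂ (f ∘ g)
  rcases hk with hk | hk
  · exact (key (g ∘ k) (g.injective.comp k.injective) fun m n hmn => Or.inr (hk m n hmn)).elim
  refine ⟨g ∘ k, g.strictMono.comp k.strictMono, fun m n hmn => ?_⟩
  rcases hmn.lt_or_gt with h | h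
  · exact hg _ _ (k.strictMono h)
  · intro h'
    exact hk _ _ h ((mul_comm _ _).trans h')

theorem ChainFinite.exists_antichain (h : ChainFinite X) {S : Set X} (hS : S.Infinite)
    (hE : ∀ p ∈ S, p * p = p) : ∃ e : ℕ → X, (∀ n, e n ∈ S) ∧ ∀ m n, m ≠ n → e m * e n ≠ e m := by
  obtain ⟨g, -, hg⟩ := h.exists_strictMono_antichain (f := fun n => (hS.natEmbedding S n : X))
    (Subtype.val_injective.comp (hS.natEmbedding S).injective) fun n => hE _ (Subtype.prop _)
  exact ⟨fun n => hS.natEmbedding S (g n), fun n => Subtype.prop _, hg⟩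

end ChainFinite

/-! ### Ideally closed semigroups are Clifford+finite -/

section CliffordPlusFinite

variable {X : Type u} [CommSemigroup X]

/-- The ideal generated by a set. -/
def idealGen (B : Set X) : Set X := {w | ∃ b ∈ B, (b : WithOne X) ∣ w}

theorem isIdealSet_idealGen (B : Set X) : IsIdealSet X (idealGen B) := by
  rintro x ⟨b, hb, hbx⟩ y
  exact ⟨⟨b, hb, by rw [WithOne.coe_mul]; exact hbx.mul_right _⟩,
    ⟨b, hb, by rw [WithOne.coe_mul]; exact hbx.mul_left _⟩⟩

theorem IdeallyTzSClosed.finite_diff_of_isIdealSet (h : IdeallyTzSClosed X) {A I : Set X}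
    (hI : IsIdealSet X I) (hA : ∀ a ∈ A, ∀ b ∈ A, a * b ∈ I) : (A \ I).Finite :=
  h.finite_of_mul_mem hI (fun _ ha => ha.2) fun a ha b hb => hA a ha.1 b hb.1

theorem mul_eq_of_coe_dvd {a b e : X} (hb : (b : WithOne X) ∣ a) (he : e * b = b) :
    e * a = a := by
  obtain ⟨u, hu⟩ := hb
  apply WithOne.coe_injective
  rw [WithOne.coe_mul, hu, ← mul_assoc, ← WithOne.coe_mul, he]

theorem IsPeriodic.idem_mul_idem_of_coe_dvd (hp : IsPeriodic X) {a b : X}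
    (hb : (b : WithOne X) ∣ a) : hp.idem a * hp.idem b = hp.idem a := by
  obtain ⟨u, hu⟩ := hb
  cases u with
  | one =>
    rw [mul_one] at hu
    rw [WithOne.coe_injective hu, hp.idem_mul_self]
  | coe u =>
    rw [← WithOne.coe_mul] at hu
    rw [WithOne.coe_injective hu, hp.idem_mul, mul_right_comm, hp.idem_mul_self]

theorem IdeallyTzSClosed.finite_image_idem (h : IdeallyTzSClosed X) (hp : IsPeriodic X)
    (hc : ChainFinite X) : (hp.idem '' {x | hp.idem x * x ≠ x}).Finite := by
  by_contra hinf
  obtain ⟨e, he, hanti⟩ := hc.exists_antichain hinf (by rintro _ ⟨x, -, rfl⟩; exact hp.idem_mul_self x)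
  have hx (n : ℕ) : ∃ x, hp.idem x = e n ∧ e n * x ≠ x ∧ e n * (x * x) = x * x := by
    obtain ⟨y, hy, hye⟩ := he n
    have hex : ∃ k, e n * spow y k = spow y k := by
      obtain ⟨k, hk⟩ := hp.exists_spow_eq_idem y
      exact ⟨k, by rw [hk, ← hye, hp.idem_mul_self]⟩
    classical
    have hk := Nat.find_spec hex
    have hmin := fun m => Nat.find_min hex (m := m)
    set k := Nat.find hex
    rcases Nat.eq_zero_or_eq_succ_pred k with h0 | h0
    · rw [h0, ← hye] at hk
      exact (hy hk).elim
    · refine ⟨spow y k.pred, by rw [hp.idem_spow, hye], hmin _ (by lia), ?_⟩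
      refine mul_eq_of_coe_dvd ?_ hk
      rw [spow_mul_spow, coe_spow, coe_spow]
      exact pow_dvd_pow _ (by lia)
  choose x hxe hx1 hx2 using hx
  have hfin := h.finite_diff_of_isIdealSet
    (isIdealSet_idealGen {w | ∃ i j, w = x i * x j}) (A := range x) (by
      rintro _ ⟨i, rfl⟩ _ ⟨j, rfl⟩
      exact ⟨_, ⟨i, j, rfl⟩, dvd_rfl⟩)
  rw [sdiff_eq_left.2] at hfin
  · refine infinite_range_of_injective (fun m n hmn => ?_) hfin
    by_contra hne
    apply hanti m n hne
    rw [← hxe m, ← hxe n, hmn, hp.idem_mul_self]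
  · rw [Set.disjoint_left]
    rintro _ ⟨n, rfl⟩ ⟨_, ⟨i, j, rfl⟩, hdvd⟩
    have h1 := hp.idem_mul_idem_of_coe_dvd ((Dvd.intro _ (WithOne.coe_mul _ _).symm).trans hdvd)
    have h2 := hp.idem_mul_idem_of_coe_dvd
      ((Dvd.intro_left _ (WithOne.coe_mul _ _).symm).trans hdvd)
    have hi : n = i := by
      by_contra hne
      apply hanti n i hne
      rwa [← hxe, ← hxe]
    have hj : n = j := by
      by_contra hne
      apply hanti n j hne
      rwa [← hxe, ← hxe]
    subst hi
    subst hj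
    exact hx1 n (mul_eq_of_coe_dvd hdvd (hx2 n))

/-- The non-Clifford elements with a fixed idempotent power. -/
def nonClifford (hp : IsPeriodic X) (e : X) : Set X := {x | hp.idem x = e ∧ e * x ≠ x}

theorem IdeallyTzSClosed.finite_dvd_nonClifford (h : IdeallyTzSClosed X) (hp : IsPeriodic X)
    {e a : X} (ha : a ∈ nonClifford hp e) : {x ∈ nonClifford hp e | (a : WithOne X) ∣ x}.Finite := by
  by_contra hinf
  let P : ℕ → Set X := fun k => {x ∈ nonClifford hp e | (a : WithOne X) ^ (k + 1) ∣ x}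
  have hex : ∃ k, (P k).Finite := by
    obtain ⟨k, hk⟩ := hp.exists_spow_eq_idem a
    refine ⟨k, ?_⟩
    convert finite_empty
    refine eq_empty_of_forall_notMem fun x hx => hx.1.2 ?_
    have h1 := hx.2
    rw [← coe_spow, hk, ha.1] at h1
    refine mul_eq_of_coe_dvd h1 ?_
    rw [← ha.1, hp.idem_mul_self]
  classical
  have hk := Nat.find_spec hex
  have hmin := fun m => Nat.find_min hex (m := m)
  set k := Nat.find hex
  rcases Nat.eq_zero_or_eq_succ_pred k with h0 | h0
  · apply hinf
    rw [h0] at hk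
    simpa [P] using hk
  · apply hmin k.pred (by lia)
    have h1 := h.finite_diff_of_isIdealSet (A := P k.pred)
      (I := {x | (a : WithOne X) ^ (k + 1) ∣ x}) (fun x hx y => by
        refine ⟨?_, ?_⟩
        · change _ ∣ ((x * y : X) : WithOne X)
          rw [WithOne.coe_mul]
          exact Dvd.dvd.mul_right hx _
        · change _ ∣ ((y * x : X) : WithOne X)
          rw [WithOne.coe_mul]
          exact Dvd.dvd.mul_left hx _) (by
        rintro x ⟨-, hx⟩ y ⟨-, hy⟩
        change _ ∣ ((x * y : X) : WithOne X)
        rw [WithOne.coe_mul]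
        refine dvd_trans ?_ (mul_dvd_mul hx hy)
        rw [← pow_add]
        exact pow_dvd_pow _ (by lia))
    refine (h1.union hk).subset fun x hx => ?_
    by_cases hxk : (a : WithOne X) ^ (k + 1) ∣ x
    · exact Or.inr ⟨hx.1, hxk⟩
    · exact Or.inl ⟨hx, hxk⟩

theorem IdeallyTzSClosed.finite_nonClifford (h : IdeallyTzSClosed X) (hp : IsPeriodic X)
    (e : X) : (nonClifford hp e).Finite := by
  by_contra hinf
  set N := nonClifford hp e with hN
  have hfin := fun a (ha : a ∈ N) => h.finite_dvd_nonClifford hp ha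
  have hM := h.finite_diff_of_isIdealSet (A := N)
    (isIdealSet_idealGen {w | ∃ b ∈ N, ∃ c ∈ N, w = b * c})
    (fun a ha b hb => ⟨_, ⟨a, ha, b, hb, rfl⟩, dvd_rfl⟩)
  set M := N \ idealGen {w | ∃ b ∈ N, ∃ c ∈ N, w = b * c}
  have hM' : (⋃ m ∈ M, {x ∈ N | (m : WithOne X) ∣ x}).Finite :=
    hM.biUnion fun m hm => hfin m hm.1
  set M' := ⋃ m ∈ M, {x ∈ N | (m : WithOne X) ∣ x} with hM'_def
  have hstep (a : X) (ha : a ∈ N \ M') :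
      ∃ b ∈ N \ M', ∃ c ∈ N, (b * c : WithOne X) ∣ a := by
    have haI : a ∈ idealGen {w | ∃ b ∈ N, ∃ c ∈ N, w = b * c} := by
      by_contra haI
      exact ha.2 (mem_biUnion (x := a) ⟨ha.1, haI⟩ ⟨ha.1, dvd_rfl⟩)
    obtain ⟨_, ⟨b, hb, c, hc, rfl⟩, hdvd⟩ := haI
    rw [WithOne.coe_mul] at hdvd
    refine ⟨b, ⟨hb, fun hbM => ha.2 ?_⟩, c, hc, hdvd⟩
    simp only [hM'_def, mem_iUnion] at hbM ⊢
    obtain ⟨m, hm, -, hmb⟩ := hbM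
    exact ⟨m, hm, ha.1, hmb.trans ((Dvd.intro _ rfl).trans hdvd)⟩
  obtain ⟨a, ha⟩ := (Set.Infinite.sdiff hinf hM').nonempty
  obtain ⟨b₀, hb₀, q₀, hq₀, hbq₀⟩ := hstep a ha
  let F : Set X := {q | q ∈ N ∧ (∃ b ∈ N \ M', (b * q : WithOne X) ∣ a) ∧ (q₀ : WithOne X) ∣ q}
  have hF : F.Finite := (hfin q₀ hq₀).subset fun q hq => ⟨hq.1, hq.2.2⟩
  let r : X → X → Prop := fun p q => p ∈ N ∧ ∃ v, hp.idem v = e ∧ p = v * q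
  have htrans : IsTrans X r := ⟨by
    rintro p q s ⟨hpN, v, hv, rfl⟩ ⟨-, w, hw, rfl⟩
    exact ⟨hpN, v * w, by rw [hp.idem_mul, hv, hw, ← hv, hp.idem_mul_self], (mul_assoc _ _ _).symm⟩⟩
  have hirr : Std.Irrefl r := ⟨by
    rintro p ⟨hpN, v, hv, hpv⟩
    apply hpN.2
    have (n : ℕ) : spow v n * p = p := by
      induction n with
      | zero => exact hpv.symm
      | succ n ih => rw [spow, mul_assoc, ← hpv, ih]
    obtain ⟨n, hn⟩ := hp.exists_spow_eq_idem v
    rw [← hv, ← hn, this]⟩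
  have : IsStrictOrder X r := { toIrrefl := hirr, toIsTrans := htrans }
  obtain ⟨q, hq, hmin⟩ := (hF.wellFoundedOn (r := r)).has_min (univ : Set F)
    ⟨⟨q₀, hq₀, ⟨b₀, hb₀, hbq₀⟩, dvd_rfl⟩, trivial⟩
  obtain ⟨q, hqN, ⟨b, hb, hbq⟩, hqq⟩ := q
  obtain ⟨b', hb', c, hc, hbc⟩ := hstep b hb
  have hdvd : (b' * (c * q : X) : WithOne X) ∣ a := by
    rw [WithOne.coe_mul, ← mul_assoc]
    exact (mul_dvd_mul_right hbc _).trans hbq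
  have hcq : c * q ∈ N := by
    refine ⟨by rw [hp.idem_mul, hc.1, hqN.1, ← hc.1, hp.idem_mul_self], fun hcq => ha.1.2 ?_⟩
    exact mul_eq_of_coe_dvd ((Dvd.intro_left _ rfl).trans hdvd) hcq
  refine hmin ⟨c * q, hcq, ⟨b', hb', hdvd⟩, ?_⟩ trivial ⟨hcq, c, hc.1, rfl⟩
  rw [WithOne.coe_mul]
  exact hqq.mul_left _

theorem IdeallyTzSClosed.cliffordPlusFinite (h : IdeallyTzSClosed X) (hp : IsPeriodic X)
    (hc : ChainFinite X) : CliffordPlusFinite X := by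
  have hN : (univ \ cliffordPart X) = {x | hp.idem x * x ≠ x} := by
    ext x
    simp [hp.mem_cliffordPart_iff]
  rw [CliffordPlusFinite, hN]
  refine Finite.of_finite_fibers hp.idem (h.finite_image_idem hp hc) fun e he => ?_
  refine (h.finite_nonClifford hp e).subset ?_
  rintro x ⟨hx, rfl⟩
  exact ⟨rfl, hx⟩

end CliffordPlusFinite

/-! ### Chain-finite bounded group-finite Clifford+finite semigroups are absolutely closed -/

theorem exists_eq_of_tendsto_of_finite_mem {X Y : Type*} [TopologicalSpace Y] [T2Space Y] {f : X → Y}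
    {u : Ultrafilter X} {y : Y} (hy : Tendsto f u (𝓝 y)) {s : Set X} (hs : s.Finite)
    (hsu : s ∈ u) : ∃ x ∈ s, f x = y := by
  obtain ⟨x, hx, rfl⟩ := Ultrafilter.eq_pure_of_finite_mem hs hsu
  exact ⟨x, hx, tendsto_nhds_unique (tendsto_pure_nhds f x) hy⟩

section Sufficiency

variable {X : Type u} [CommSemigroup X]

theorem absolutelyT2SClosed_of_chainFinite (hc : ChainFinite X) (hb : BoundedSemigroup X)
    (hg : GroupFinite X) (hcl : CliffordPlusFinite X) : AbsolutelyT2SClosed X := by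
  have hp := hb.isPeriodic
  obtain ⟨n, hn⟩ := hb
  have hidem (x : X) : spow x n = hp.idem x := hp.spow_eq_idem (hn x)
  intro Y _ _ _ _ f
  refine isClosed_of_closure_subset fun y hy => ?_
  obtain ⟨v, hv, hvy⟩ := mem_closure_iff_ultrafilter.1 hy
  have hne : (comap f v).NeBot := v.neBot.comap_of_range_mem hv
  set u : Ultrafilter X := Ultrafilter.of (comap f v)
  have hu : Tendsto f u (𝓝 y) :=
    (tendsto_comap.mono_left (Ultrafilter.of_le _)).mono_right hvy
  by_cases hmem : univ \ cliffordPart X ∈ u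
  · obtain ⟨x, -, hx⟩ := exists_eq_of_tendsto_of_finite_mem hu hcl hmem
    exact ⟨x, hx⟩
  have hev : ∀ᶠ x in (u : Filter X), hp.idem x * x = x := by
    filter_upwards [Ultrafilter.compl_mem_iff_notMem.2 hmem] with x hx
    simpa [hp.mem_cliffordPart_iff] using hx
  set ε := spow y n
  have hε : Tendsto (fun x => f (hp.idem x)) u (𝓝 ε) := by
    have := ((continuous_spow n).tendsto y).comp hu
    refine this.congr fun x => ?_
    rw [← hidem, map_spow]
    rfl
  have hεε : ε * ε = ε := by
    refine tendsto_nhds_unique (hε.mul hε) (hε.congr fun x => ?_)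
    rw [← map_mul, hp.idem_mul_self]
  let P : Set X := {p | p * p = p ∧ ∀ᶠ x in (u : Filter X), p * hp.idem x = p}
  have key (C : Set X) (hCmul : ∀ p ∈ C, ∀ q ∈ C, p * q ∈ C)
      (hC : ∀ᶠ x in (u : Filter X), hp.idem x ∈ C) (W : Set Y) (hW : IsOpen W) (hεW : ε ∈ W) :
      ∃ p ∈ P, p ∈ C ∧ f p ∈ W := by
    let S : Set X := {p | p * p = p ∧ p ∈ C ∧ f p ∈ W ∧ f p * ε ∈ W}
    have hS : S.Nonempty := by
      have h1 := hε.eventually (hW.mem_nhds hεW)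
      have h2 : Tendsto (fun x => f (hp.idem x) * ε) u (𝓝 ε) := by
        simpa only [hεε] using hε.mul_const ε
      obtain ⟨x, hx1, hx2, hx3⟩ := (h1.and ((h2.eventually (hW.mem_nhds hεW)).and hC)).exists
      exact ⟨_, hp.idem_mul_self x, hx3, hx1, hx2⟩
    obtain ⟨p, ⟨hpp, hpC, hpW, hpW'⟩, hmin⟩ := hc.exists_minimal hS fun p hp => hp.1
    refine ⟨p, ⟨hpp, ?_⟩, hpC, hpW⟩
    have h1 : Tendsto (fun x => f (p * hp.idem x)) u (𝓝 (f p * ε)) :=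
      (hε.const_mul (f p)).congr fun x => (map_mul f _ _).symm
    have h2 : Tendsto (fun x => f (p * hp.idem x) * ε) u (𝓝 (f p * ε)) := by
      simpa only [mul_assoc, hεε] using h1.mul_const ε
    filter_upwards [h1.eventually (hW.mem_nhds hpW'), h2.eventually (hW.mem_nhds hpW'), hC]
      with x hx1 hx2 hx3
    refine hmin _ ⟨?_, hCmul _ hpC _ hx3, hx1, hx2⟩ ?_
    · rw [mul_mul_mul_comm, hpp, hp.idem_mul_self]
    · rw [mul_right_comm, hpp]
  obtain ⟨p₀, hp₀, -⟩ := key univ (fun _ _ _ _ => trivial) (by simp) univ isOpen_univ trivial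
  obtain ⟨m, hm, hmax⟩ := hc.exists_maximal ⟨p₀, hp₀⟩ fun p hp => hp.1
  have hfm : f m = ε := by
    by_contra hne
    obtain ⟨p, hpP, hpC, hpW⟩ := key {p | m * p = m}
      (fun p hp q hq => by
        change m * (p * q) = m
        rw [← mul_assoc, show m * p = m from hp, show m * q = m from hq]) hm.2 {f m}ᶜ
      isOpen_compl_singleton (fun h => hne h.symm)
    rw [hmax p hpP hpC] at hpW
    exact hpW rfl
  have hyε : y * ε = y := by
    refine tendsto_nhds_unique (hu.mul hε) (hu.congr' ?_)
    filter_upwards [hev] with x hx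
    rw [← map_mul, mul_comm, hx]
  have hlim : Tendsto f (u.map (· * m)) (𝓝 y) := by
    have := hu.mul_const (f m)
    rw [hfm, hyε, ← hfm] at this
    rw [Ultrafilter.coe_map, tendsto_map'_iff]
    exact this.congr fun x => (map_mul f _ _).symm
  obtain ⟨x, -, hx⟩ := exists_eq_of_tendsto_of_finite_mem hlim
    (hg _ (isSubgroupSet_maxSubgroup hm.1)) (by
      rw [Ultrafilter.mem_map]
      filter_upwards [hm.2] with x hx
      refine (hp.mul_mem_maxSubgroup_iff hm.1).2 ?_
      rw [mul_comm, hx])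
  exact ⟨x, hx⟩

end Sufficiency

/-! ### Absolutely closed semigroups are periodic -/

section Periodic

variable {X : Type u} [CommSemigroup X]

theorem injective_pow_of_forall_spow_notMem {x : X} (h : ∀ n, spow x n ∉ idemSet X) :
    Function.Injective fun n : ℕ => (x : WithOne X) ^ n := by
  have key (i d : ℕ) (hid : (x : WithOne X) ^ i = x ^ (i + (d + 1))) : False := by
    have h1 (k : ℕ) : (x : WithOne X) ^ (i + k * (d + 1)) = x ^ i := by
      induction k with
      | zero => simp
      | succ k ih =>
        rw [show i + (k + 1) * (d + 1) = i + (d + 1) + k * (d + 1) by ring, pow_add, ← hid,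
          ← pow_add, ih]
    have h2 (m k : ℕ) (hm : i ≤ m) : (x : WithOne X) ^ (m + k * (d + 1)) = x ^ m := by
      obtain ⟨m, rfl⟩ := Nat.exists_eq_add_of_le hm
      rw [show i + m + k * (d + 1) = i + k * (d + 1) + m by ring, pow_add, h1, pow_add]
    apply h (i * d + i + d)
    apply WithOne.coe_injective
    rw [WithOne.coe_mul, coe_spow, ← pow_add,
      show i * d + i + d + 1 = (i + 1) * (d + 1) by ring, h2]
    nlinarith
  intro i j hij
  rcases lt_trichotomy i j with h | h | h
  · obtain ⟨d, rfl⟩ := Nat.exists_eq_add_of_lt h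
    exact (key i d hij).elim
  · exact h
  · obtain ⟨d, rfl⟩ := Nat.exists_eq_add_of_lt h
    exact (key j d hij.symm).elim

/-- Two divisors of powers of `x` are identified if they differ by a power of `x` with exponent
divisible by `N`, and all nondivisors are identified. -/
def powerCon (x : X) (N : ℕ) : Con X where
  r y z := ((¬ ∃ k, (y : WithOne X) ∣ x ^ k) ∧ ¬ ∃ k, (z : WithOne X) ∣ x ^ k) ∨
    ((∃ k, (y : WithOne X) ∣ x ^ k) ∧ (∃ k, (z : WithOne X) ∣ x ^ k) ∧
      ∃ a b, (y : WithOne X) * x ^ a = z * x ^ b ∧ a ≡ b [MOD N])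
  iseqv :=
    { refl := fun y => by
        by_cases hy : ∃ k, (y : WithOne X) ∣ x ^ k
        · exact Or.inr ⟨hy, hy, 0, 0, rfl, rfl⟩
        · exact Or.inl ⟨hy, hy⟩
      symm := by
        rintro y z (⟨h1, h2⟩ | ⟨h1, h2, a, b, h3, h4⟩)
        exacts [Or.inl ⟨h2, h1⟩, Or.inr ⟨h2, h1, b, a, h3.symm, h4.symm⟩]
      trans := by
        rintro y z w (⟨h1, h2⟩ | ⟨h1, h2, a, b, h3, h4⟩) (⟨h5, h6⟩ | ⟨h5, h6, c, d, h7, h8⟩)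
        · exact Or.inl ⟨h1, h6⟩
        · exact (h2 h5).elim
        · exact (h5 h2).elim
        · refine Or.inr ⟨h1, h6, a + c, d + b, ?_, ?_⟩
          · rw [pow_add, ← mul_assoc, h3, mul_right_comm, h7, mul_assoc, pow_add]
          · rw [add_comm d b]
            exact h4.add h8 }
  mul' := by
    have aux {y z : X} (h : ∃ k, ((y * z : X) : WithOne X) ∣ x ^ k) :
        (∃ k, (y : WithOne X) ∣ x ^ k) ∧ ∃ k, (z : WithOne X) ∣ x ^ k := by
      obtain ⟨k, hk⟩ := h
      rw [WithOne.coe_mul] at hk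
      exact ⟨⟨k, (Dvd.intro _ rfl).trans hk⟩, k, (Dvd.intro_left _ rfl).trans hk⟩
    have aux' {y z : X} (h : ∃ k, (y : WithOne X) ∣ x ^ k) (h' : ∃ k, (z : WithOne X) ∣ x ^ k) :
        ∃ k, ((y * z : X) : WithOne X) ∣ x ^ k := by
      obtain ⟨k, hk⟩ := h
      obtain ⟨l, hl⟩ := h'
      exact ⟨k + l, by rw [WithOne.coe_mul, pow_add]; exact mul_dvd_mul hk hl⟩
    rintro y z y' z' (⟨h1, h2⟩ | ⟨h1, h2, a, b, h3, h4⟩) (⟨h5, h6⟩ | ⟨h5, h6, c, d, h7, h8⟩)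
    · exact Or.inl ⟨fun h => h1 (aux h).1, fun h => h2 (aux h).1⟩
    · exact Or.inl ⟨fun h => h1 (aux h).1, fun h => h2 (aux h).1⟩
    · exact Or.inl ⟨fun h => h5 (aux h).2, fun h => h6 (aux h).2⟩
    · refine Or.inr ⟨aux' h1 h5, aux' h2 h6, a + c, b + d, ?_, h4.add h8⟩
      rw [WithOne.coe_mul, WithOne.coe_mul, pow_add, pow_add, mul_mul_mul_comm, h3, h7,
        mul_mul_mul_comm]

theorem AbsolutelyTzSClosed.isPeriodic (h : AbsolutelyTzSClosed X) : IsPeriodic X := by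
  intro x
  by_contra! hx
  have hinj := injective_pow_of_forall_spow_notMem hx
  have hpow (k : ℕ) : ((spow x (4 ^ k - 1) : X) : WithOne X) = x ^ 4 ^ k := by
    rw [coe_spow, Nat.sub_add_cancel (Nat.one_le_pow _ _ (by norm_num))]
  obtain ⟨z, hz⟩ := h.exists_forall_con (fun k => powerCon x (3 * 2 ^ k))
    (fun k => spow x (4 ^ k - 1)) fun n => by
      refine ⟨spow x (4 ^ n - 1), fun i hi => Or.inr ⟨⟨_, (hpow n).dvd⟩, ⟨_, (hpow i).dvd⟩,
        4 ^ i, 4 ^ n, by rw [hpow, hpow, mul_comm], ?_⟩⟩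
      obtain ⟨d, rfl⟩ := Nat.exists_eq_add_of_le hi
      have h1 : 1 ≡ 4 ^ d [MOD 3] := by
        simpa using (show 1 ≡ 4 [MOD 3] from rfl).pow d
      have h2 := h1.mul_left' (4 ^ i)
      rw [mul_one, ← pow_add] at h2
      refine h2.of_dvd ?_
      rw [mul_comm]
      exact mul_dvd_mul_right (pow_dvd_pow_of_dvd (by norm_num) i) 3
  have hz' (k : ℕ) : ∃ a b : ℕ, (z : WithOne X) * x ^ a = x ^ (4 ^ k + b) ∧
      a ≡ b [MOD 3 * 2 ^ k] := by
    rcases hz k with ⟨-, h2⟩ | ⟨-, -, a, b, h3, h4⟩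
    · exact (h2 ⟨_, (hpow k).dvd⟩).elim
    · exact ⟨a, b, by rw [h3, hpow, pow_add], h4⟩
  choose a b hab hmod using hz'
  have heq (k : ℕ) : 1 + b 0 + a k = 4 ^ k + b k + a 0 := by
    apply hinj
    change (x : WithOne X) ^ _ = x ^ _
    rw [pow_add, pow_add _ _ (a 0), ← hab k, show 1 = 4 ^ 0 from rfl, ← hab 0]
    exact mul_right_comm _ _ _
  have hdvd (k : ℕ) : (2 ^ k : ℤ) ∣ 1 + b 0 - a 0 := by
    have h1 : (1 + b 0 - a 0 : ℤ) = 4 ^ k + (b k - a k) := by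
      have := heq k
      zify at this
      linarith
    rw [h1]
    refine dvd_add (pow_dvd_pow_of_dvd (by norm_num) k) ?_
    have := (hmod k).dvd
    push_cast at this
    exact (Dvd.intro_left _ rfl).trans this
  have hzero : (1 + b 0 - a 0 : ℤ) = 0 := by
    by_contra hne
    have h1 := Int.le_of_dvd (abs_pos.2 hne) ((dvd_abs _ _).2 (hdvd (1 + b 0 - a 0 : ℤ).natAbs))
    rw [Int.abs_eq_natAbs] at h1
    have h2 := Nat.lt_two_pow_self (n := (1 + b 0 - a 0 : ℤ).natAbs)
    exact absurd (by exact_mod_cast h1) h2.not_ge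
  have h3 := (hmod 0).dvd
  push_cast at h3
  lia

end Periodic

/-! ### Homomorphisms to maximal subgroups with zero -/

section MaxGroup

variable {X : Type u} [CommSemigroup X] {e : X}

/-- The maximal subgroup at an idempotent, as a type. -/
def MaxGroup (_he : e * e = e) : Type u := maxSubgroup X e

noncomputable instance (he : e * e = e) : CommGroup (MaxGroup he) := maxSubgroupCommGroup he

namespace MaxGroup

variable (he : e * e = e)

/-- The element of `X` underlying an element of a maximal subgroup. -/
def val : MaxGroup he →ₙ* X := ⟨Subtype.val, fun _ _ => rfl⟩

theorem val_injective : Function.Injective (val he) := Subtype.val_injective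

theorem val_mem (g : MaxGroup he) : val he g ∈ maxSubgroup X e := Subtype.prop g

/-- The element of a maximal subgroup given by an element of `X`. -/
def mk {x : X} (hx : x ∈ maxSubgroup X e) : MaxGroup he := ⟨x, hx⟩

theorem val_mk {x : X} (hx : x ∈ maxSubgroup X e) : val he (mk he hx) = x := rfl

theorem val_one : val he 1 = e := rfl

theorem val_pow (g : MaxGroup he) (n : ℕ) : val he (g ^ (n + 1)) = spow (val he g) n := by
  induction n with
  | zero => rw [zero_add, pow_one]; rfl
  | succ n ih => rw [pow_succ, map_mul, ih, spow]

end MaxGroup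

variable (hp : IsPeriodic X) (he : e * e = e)

theorem IsPeriodic.isOfFinOrder_maxGroup (hp : IsPeriodic X) (g : MaxGroup he) :
    ∃ n : ℕ, 0 < n ∧ g ^ n = 1 := by
  obtain ⟨n, hn⟩ := hp.exists_spow_eq_idem (MaxGroup.val he g)
  refine ⟨n + 1, n.succ_pos, MaxGroup.val_injective he ?_⟩
  rw [MaxGroup.val_pow, hn, MaxGroup.val_one,
    ((hp.mem_maxSubgroup_iff he).1 (MaxGroup.val_mem he g)).1]

theorem IsPeriodic.idem_mul_mul_eq_iff (x y : X) :
    hp.idem (x * y) * e = e ↔ hp.idem x * e = e ∧ hp.idem y * e = e := by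
  rw [hp.idem_mul]
  refine ⟨fun h => ⟨?_, ?_⟩, fun h => by rw [mul_assoc, h.2, h.1]⟩
  · rw [← h, ← mul_assoc, ← mul_assoc, hp.idem_mul_self]
  · rw [← h, ← mul_assoc, mul_left_comm, hp.idem_mul_self]

open Classical in
/-- The canonical homomorphism onto a maximal subgroup with zero. -/
noncomputable def IsPeriodic.toMaxGroup : X →ₙ* WithZero (MaxGroup he) where
  toFun x := if h : hp.idem x * e = e then
    (MaxGroup.mk he ((hp.mul_mem_maxSubgroup_iff he).2 h) : WithZero (MaxGroup he)) else 0
  map_mul' x y := by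
    by_cases hx : hp.idem x * e = e
    · by_cases hy : hp.idem y * e = e
      · have hxy := (hp.idem_mul_mul_eq_iff x y).2 ⟨hx, hy⟩
        simp only [hx, hy, hxy, dif_pos]
        rw [← WithZero.coe_mul]
        refine congrArg _ (MaxGroup.val_injective he ?_)
        rw [map_mul, MaxGroup.val_mk, MaxGroup.val_mk, MaxGroup.val_mk, mul_mul_mul_comm, he]
      · have hxy : ¬ hp.idem (x * y) * e = e := fun h => hy ((hp.idem_mul_mul_eq_iff x y).1 h).2
        simp [hxy, hy]
    · have hxy : ¬ hp.idem (x * y) * e = e := fun h => hx ((hp.idem_mul_mul_eq_iff x y).1 h).1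
      simp [hxy, hx]

theorem IsPeriodic.toMaxGroup_of_ne {x : X} (h : hp.idem x * e ≠ e) : hp.toMaxGroup he x = 0 :=
  dif_neg h

theorem IsPeriodic.exists_toMaxGroup_eq {x : X} (h : hp.idem x * e = e) :
    ∃ g, MaxGroup.val he g = x * e ∧ hp.toMaxGroup he x = g :=
  ⟨_, MaxGroup.val_mk he _, dif_pos h⟩

theorem IsPeriodic.toMaxGroup_val (g : MaxGroup he) :
    hp.toMaxGroup he (MaxGroup.val he g) = g := by
  have h := (hp.mem_maxSubgroup_iff he).1 (MaxGroup.val_mem he g)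
  obtain ⟨g', hg', hgg'⟩ := hp.exists_toMaxGroup_eq he (x := MaxGroup.val he g)
    (by rw [h.1, he])
  rw [hgg', MaxGroup.val_injective he (hg'.trans ?_)]
  rw [mul_comm, h.2]

end MaxGroup

/-! ### Characters of abelian groups -/

section Characters

/-- The standard embedding of `ℚ/ℤ` into the circle. -/
noncomputable def ratCircle : AddCircle (1 : ℚ) →+ Additive Circle :=
  QuotientAddGroup.lift (AddSubgroup.zmultiples 1)
    (Circle.expHom.comp ((AddMonoidHom.mulLeft (2 * Real.pi)).comp (Rat.castHom ℝ).toAddMonoidHom)) (by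
      rw [AddSubgroup.zmultiples_le]
      change Circle.exp (2 * Real.pi * ((1 : ℚ) : ℝ)) = 1
      simp)

theorem ratCircle_injective : Function.Injective ratCircle := by
  rw [injective_iff_map_eq_zero]
  rintro ⟨q⟩ hq
  have hq : Circle.exp (2 * Real.pi * (q : ℝ)) = Circle.exp 0 := hq.trans Circle.exp_zero.symm
  obtain ⟨m, hm⟩ := Circle.exp_eq_exp.1 hq
  refine (QuotientAddGroup.eq_zero_iff q).2 (AddSubgroup.mem_zmultiples_iff.2 ⟨m, ?_⟩)
  rw [zero_add, mul_comm] at hm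
  have := mul_right_cancel₀ Real.two_pi_pos.ne' hm
  rw [zsmul_one]
  exact_mod_cast this.symm

theorem exists_circle_hom_apply_ne_one {G : Type*} [CommGroup G] {g : G} (hg : g ≠ 1) :
    ∃ f : G →* Circle, f g ≠ 1 := by
  obtain ⟨c, hc⟩ := CharacterModule.exists_character_apply_ne_zero_of_ne_zero
    (a := Additive.ofMul g) hg
  refine ⟨AddMonoidHom.toMultiplicativeLeft (ratCircle.comp c), fun h => hc ?_⟩
  exact ratCircle_injective (h.trans (map_zero ratCircle).symm)

/-- An unbounded abelian group has a character of infinite order. -/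
theorem exists_circle_hom_pow_ne_one {G : Type*} [CommGroup G]
    (hG : ∀ m : ℕ, 0 < m → ∃ g : G, g ^ m ≠ 1) :
    ∃ f : G →* Circle, ∀ m : ℕ, 0 < m → ∃ g, f g ^ m ≠ 1 := by
  by_contra! hcon
  let _ : TopologicalSpace G := ⊥
  have : DiscreteTopology G := ⟨rfl⟩
  have happly (f : PontryaginDual G) (m : ℕ) (g : G) : (f ^ m) g = f g ^ m := by
    induction m with
    | zero => rw [pow_zero, pow_zero]; rfl
    | succ m ih => rw [pow_succ, pow_succ, ← ih]; rfl
  let A : ℕ → Subgroup (PontryaginDual G) := fun m => (powMonoidHom (m + 1)).ker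
  have hA (m : ℕ) : IsClosed (A m : Set (PontryaginDual G)) :=
    isClosed_singleton.preimage (continuous_pow (m + 1))
  have hU : ⋃ m, (A m : Set (PontryaginDual G)) = univ := by
    refine eq_univ_of_forall fun f => ?_
    obtain ⟨m, hm, hf⟩ := hcon (f : G →ₜ* Circle).toMonoidHom
    refine mem_iUnion.2 ⟨m - 1, ?_⟩
    change f ^ (m - 1 + 1) = 1
    rw [Nat.sub_add_cancel hm]
    refine DFunLike.ext _ _ fun g => ?_
    rw [happly]
    exact hf g
  obtain ⟨m, x, hx⟩ := nonempty_interior_of_iUnion_of_closed hA hU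
  have hopen := (A m).isOpen_of_mem_nhds (mem_interior_iff_mem_nhds.1 hx)
  have := (A m).quotient_finite_of_isOpen hopen
  have hfi : (A m).FiniteIndex := Subgroup.finiteIndex_of_finite_quotient
  obtain ⟨g, hg⟩ := hG ((A m).index * (m + 1))
    (Nat.mul_pos (Nat.pos_of_ne_zero hfi.index_ne_zero) m.succ_pos)
  obtain ⟨f, hf⟩ := exists_circle_hom_apply_ne_one hg
  let F : PontryaginDual G := (⟨f, continuous_of_discreteTopology⟩ : G →ₜ* Circle)
  have h1 : (F ^ (A m).index) ^ (m + 1) = 1 := (A m).pow_index_mem F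
  rw [← pow_mul] at h1
  have h2 := congrArg (fun f : PontryaginDual G => f g) h1
  simp only [happly] at h2
  apply hf
  rw [map_pow]
  exact h2

theorem Circle.finite_setOf_pow_eq_one {n : ℕ} (hn : 0 < n) : {z : Circle | z ^ n = 1}.Finite := by
  refine Finite.of_finite_image (f := fun z : Circle => (z : ℂ)) ?_ Circle.coe_injective.injOn
  refine (Polynomial.nthRoots n (1 : ℂ)).toFinset.finite_toSet.subset ?_
  rintro _ ⟨z, hz, rfl⟩
  rw [Finset.mem_coe, Multiset.mem_toFinset, Polynomial.mem_nthRoots hn]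
  exact_mod_cast congrArg (fun z : Circle => (z : ℂ)) hz

theorem Circle.exp_one_pow_ne_one {n : ℕ} (hn : 0 < n) : Circle.exp 1 ^ n ≠ 1 := by
  rw [← Circle.exp_nsmul, nsmul_one, ← Circle.exp_zero, Ne, Circle.exp_eq_exp]
  rintro ⟨m, hm⟩
  have hm0 : m ≠ 0 := by
    rintro rfl
    simp at hm
    lia
  refine irrational_pi ⟨n / (2 * m), ?_⟩
  have : (m : ℝ) ≠ 0 := by exact_mod_cast hm0
  push_cast
  field_simp
  linarith

/-- An infinite torsion subgroup of the circle is dense. -/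
theorem Circle.dense_of_infinite_of_pow_eq_one (T : Subgroup Circle) (hT : (T : Set Circle).Infinite)
    (htor : ∀ z ∈ T, ∃ n : ℕ, 0 < n ∧ z ^ n = 1) : Dense (T : Set Circle) := by
  let S : AddSubgroup ℝ := (Subgroup.toAddSubgroup T).comap Circle.expHom
  have himage : Circle.exp '' S = T := by
    ext z
    constructor
    · rintro ⟨r, hr, rfl⟩
      exact hr
    · intro hz
      obtain ⟨r, rfl⟩ := Circle.exp_surjective z
      exact ⟨r, hz, rfl⟩
  rcases S.dense_or_cyclic with hS | ⟨a, ha⟩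
  · rw [← himage]
    exact Circle.exp_surjective.denseRange.dense_image Circle.exp.continuous hS
  · have haT : Circle.exp a ∈ T := by
      have : a ∈ S := ha ▸ AddSubgroup.subset_closure rfl
      exact this
    obtain ⟨n, hn, han⟩ := htor _ haT
    refine (hT ((Circle.finite_setOf_pow_eq_one hn).subset ?_)).elim
    rw [← himage]
    rintro _ ⟨r, hr, rfl⟩
    rw [ha, SetLike.mem_coe, AddSubgroup.mem_closure_singleton] at hr
    obtain ⟨k, rfl⟩ := hr
    rw [mem_ofPred_eq, Circle.exp_zsmul, ← zpow_natCast, zpow_comm, zpow_natCast, han, one_zpow]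

end Characters

section MaxGroup

variable {X : Type u} [CommSemigroup X] {e : X}

/-- The nonnegative powers of a number up to roots of unity, together with zero. -/
def rootsMulPowers (w : ℂ) : Subsemigroup ℂ where
  carrier := {z | z = 0 ∨ ∃ n : ℕ, 0 < n ∧ ∃ k : ℕ, ∃ t : ℂ, t ^ n = 1 ∧ z = t * w ^ k}
  mul_mem' := by
    rintro _ _ (rfl | ⟨n, hn, k, t, ht, rfl⟩) (rfl | ⟨m, hm, l, s, hs, rfl⟩)
    · exact Or.inl (by simp)
    · exact Or.inl (by simp)
    · exact Or.inl (by simp)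
    · refine Or.inr ⟨n * m, Nat.mul_pos hn hm, k + l, t * s, ?_, by ring⟩
      rw [mul_pow, pow_mul, ht, mul_comm n m, pow_mul, hs, one_pow, one_pow, one_mul]

theorem countable_rootsMulPowers (w : ℂ) : Countable (rootsMulPowers w) := by
  have h : {z : ℂ | z = 0 ∨ ∃ n : ℕ, 0 < n ∧ ∃ k : ℕ, ∃ t : ℂ, t ^ n = 1 ∧ z = t * w ^ k} ⊆
      {0} ∪ ⋃ n : ℕ, ⋃ k : ℕ, (fun t => t * w ^ k) '' (Polynomial.nthRoots n (1 : ℂ)).toFinset := by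
    rintro _ (rfl | ⟨n, hn, k, t, ht, rfl⟩)
    · exact Or.inl rfl
    · refine Or.inr (mem_iUnion₂.2 ⟨n, k, t, ?_, rfl⟩)
      rwa [Finset.mem_coe, Multiset.mem_toFinset, Polynomial.mem_nthRoots hn]
  exact (((countable_singleton _).union (countable_iUnion fun n => countable_iUnion fun k =>
    ((Finset.finite_toSet _).countable.image _))).mono h).to_subtype

theorem AbsolutelyTzSClosed.exists_pow_eq_one (h : AbsolutelyTzSClosed X) (hp : IsPeriodic X)
    (he : e * e = e) : ∃ m : ℕ, 0 < m ∧ ∀ g : MaxGroup he, g ^ m = 1 := by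
  by_contra! hcon
  obtain ⟨f, hf⟩ := exists_circle_hom_pow_ne_one hcon
  have htor (g : MaxGroup he) : ∃ n : ℕ, 0 < n ∧ f g ^ n = 1 := by
    obtain ⟨n, hn, hg⟩ := hp.isOfFinOrder_maxGroup he g
    exact ⟨n, hn, by rw [← map_pow, hg, map_one]⟩
  have hdense : Dense (f.range : Set Circle) := by
    refine Circle.dense_of_infinite_of_pow_eq_one _ (fun hfin => ?_) ?_
    · have : Finite f.range := hfin
      obtain ⟨g, hg⟩ := hf (Nat.card f.range) Nat.card_pos
      exact hg (congrArg Subtype.val (pow_card_eq_one' (x := (⟨f g, g, rfl⟩ : f.range))))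
    · rintro _ ⟨g, rfl⟩
      exact htor g
  let S := rootsMulPowers (Circle.exp 1)
  have : Countable S := countable_rootsMulPowers _
  let φ : X →ₙ* ℂ := ((WithZero.lift' (Circle.coeHom.comp f) : _ →*₀ ℂ) : _ →ₙ* ℂ).comp
    (hp.toMaxGroup he)
  have hφ0 {x : X} (hx : hp.idem x * e ≠ e) : φ x = 0 := by
    change WithZero.lift' _ (hp.toMaxGroup he x) = 0
    rw [hp.toMaxGroup_of_ne he hx, map_zero]
  have hφ1 {x : X} (hx : hp.idem x * e = e) : ∃ g, φ x = f g := by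
    obtain ⟨g, -, hg⟩ := hp.exists_toMaxGroup_eq he hx
    refine ⟨g, ?_⟩
    change WithZero.lift' _ (hp.toMaxGroup he x) = _
    rw [hg]
    rfl
  have hφ2 (g : MaxGroup he) : φ (MaxGroup.val he g) = f g := by
    change WithZero.lift' _ (hp.toMaxGroup he _) = _
    rw [hp.toMaxGroup_val]
    rfl
  have hφS (x : X) : φ x ∈ S := by
    by_cases hx : hp.idem x * e = e
    · obtain ⟨g, hg⟩ := hφ1 hx
      obtain ⟨n, hn, hgn⟩ := htor g
      refine Or.inr ⟨n, hn, 0, f g, by exact_mod_cast congrArg (fun z : Circle => (z : ℂ)) hgn, ?_⟩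
      rw [hg, pow_zero, mul_one]
    · exact Or.inl (hφ0 hx)
  have hcl := h.isClosed_range S (.of_countable S) (φ.codRestrict S hφS)
  have hw : ((Circle.exp 1 : Circle) : ℂ) ∈ S := Or.inr ⟨1, one_pos, 1, 1, by simp, by simp⟩
  have : (⟨_, hw⟩ : S) ∈ range (φ.codRestrict S hφS) := by
    rw [← hcl.closure_eq, closure_subtype]
    have h1 : ((Circle.exp 1 : Circle) : ℂ) ∈ (fun z : Circle => (z : ℂ)) '' closure f.range :=
      ⟨_, hdense _, rfl⟩
    refine closure_mono ?_ (image_closure_subset_closure_image continuous_induced_dom h1)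
    rintro _ ⟨_, ⟨g, rfl⟩, rfl⟩
    exact ⟨⟨f g, hφ2 g ▸ hφS _⟩, ⟨MaxGroup.val he g, Subtype.ext (hφ2 g)⟩, rfl⟩
  obtain ⟨x, hx⟩ := this
  have hx : φ x = (Circle.exp 1 : Circle) := congrArg Subtype.val hx
  by_cases hxe : hp.idem x * e = e
  · obtain ⟨g, hg⟩ := hφ1 hxe
    obtain ⟨n, hn, hgn⟩ := htor g
    rw [hg] at hx
    exact Circle.exp_one_pow_ne_one hn (Circle.coe_injective hx ▸ hgn)
  · rw [hφ0 hxe] at hx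
    exact Circle.coe_ne_zero _ hx.symm

end MaxGroup

/-! ### Topologies with finitely many nontrivial neighborhood filters -/

/-- A topology on a commutative semigroup is obtained by prescribing the filter of punctured
neighborhoods of each point. -/
theorem exists_topology_of_tail {Y : Type*} [CommSemigroup Y] (tail : Y → Filter Y)
    (htail : ∀ a, ∀ᶠ c in tail a, tail c = ⊥) (hne : ∀ a b, ∀ᶠ c in tail a, c ≠ b)
    (hsep : ∀ a, ∃ W ∈ tail a, ∀ b ≠ a, Wᶜ ∈ tail b)
    (hmul : ∀ a b, Tendsto (a * ·) (tail b) (pure (a * b) ⊔ tail (a * b)))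
    (hmul' : ∀ a b, Tendsto (fun p : Y × Y => p.1 * p.2) (tail a ×ˢ tail b)
      (pure (a * b) ⊔ tail (a * b))) :
    ∃ _ : TopologicalSpace Y, ContinuousMul Y ∧ T1Space Y ∧ HasClopenBasis Y ∧
      ∀ a, tail a ≤ 𝓝 a := by
  let t : TopologicalSpace Y :=
    { IsOpen := fun s => ∀ a ∈ s, s ∈ tail a
      isOpen_univ := fun _ _ => univ_mem
      isOpen_inter := fun s t hs ht a ha => inter_mem (hs a ha.1) (ht a ha.2)
      isOpen_sUnion := fun S hS a ⟨s, hs, ha⟩ =>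
        mem_of_superset (hS s hs a ha) (subset_sUnion_of_mem hs) }
  have hopen {s : Set Y} : IsOpen s ↔ ∀ a ∈ s, s ∈ tail a := Iff.rfl
  have hopen' (a : Y) (s : Set Y) (hs : s ∈ tail a) : IsOpen (insert a (s ∩ {c | tail c = ⊥})) := by
    rw [hopen]
    rintro b (rfl | ⟨-, hb⟩)
    · exact mem_of_superset (inter_mem hs (htail b)) (subset_insert _ _)
    · rw [show tail b = ⊥ from hb]
      exact mem_bot
  have hnhds (a : Y) : 𝓝 a = pure a ⊔ tail a := by
    refine le_antisymm (fun s hs => ?_) (sup_le (pure_le_nhds a) fun s hs => ?_)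
    · refine mem_nhds_iff.2 ⟨_, ?_, hopen' a s hs.2, mem_insert _ _⟩
      exact insert_subset (mem_pure.1 hs.1) inter_subset_left
    · obtain ⟨u, hus, hu, ha⟩ := mem_nhds_iff.1 hs
      exact mem_of_superset (hu a ha) hus
  refine ⟨t, ⟨continuous_iff_continuousAt.2 fun ⟨a, b⟩ => ?_⟩, ?_, .of_nhds fun a U hU => ?_,
    fun a => hnhds a ▸ le_sup_right⟩
  · rw [ContinuousAt, nhds_prod_eq, hnhds, hnhds, hnhds, Filter.sup_prod, Filter.prod_sup,
      Filter.prod_sup]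
    refine ((tendsto_sup.2 ⟨?_, ?_⟩).sup_sup (tendsto_sup.2 ⟨?_, hmul' a b⟩)).mono_right
      (sup_le le_rfl le_rfl)
    · rw [Filter.prod_pure_pure]
      exact (tendsto_pure_pure _ _).mono_right le_sup_left
    · rw [Filter.pure_prod, tendsto_map'_iff]
      exact hmul a b
    · rw [Filter.prod_pure, tendsto_map'_iff, mul_comm a b]
      exact (hmul b a).congr fun c => mul_comm _ _
  · exact ⟨fun b => ⟨hopen.2 fun a _ => hne a b⟩⟩
  · obtain ⟨W, hWa, hWb⟩ := hsep a
    rw [hnhds] at hU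
    refine ⟨_, ⟨⟨hopen.2 fun b hb => ?_⟩, hopen' a (U ∩ W) (inter_mem hU.2 hWa)⟩,
      mem_insert _ _, insert_subset (mem_pure.1 hU.1) fun c hc => hc.1.1⟩
    have hba : b ≠ a := fun h => hb (Or.inl h)
    filter_upwards [hne b a, hWb b hba] with c hc1 hc2
    rintro (h | h)
    exacts [hc1 h, hc2 h.1.2]

/-- The group `ℚ/ℤ`, written multiplicatively, with a zero. -/
abbrev CircleZero : Type := WithZero (Multiplicative (AddCircle (1 : ℚ)))

/-- Sequences which are eventually `0` or eventually `1` along an ultrafilter, marked by `0` or `1`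
respectively, together with an additional element whose square is zero. -/
def markedSeq : Subsemigroup ((ℕ → CircleZero) × ZMod 4) where
  carrier := {p | ((∀ᶠ n in hyperfilter ℕ, p.1 n = 0) ∧ p.2 = 0) ∨
    ((∀ᶠ n in hyperfilter ℕ, p.1 n = 1) ∧ p.2 = 1) ∨ p = (0, 2)}
  mul_mem' := by
    have h0 (p q : (ℕ → CircleZero) × ZMod 4) (h : ∀ᶠ n in hyperfilter ℕ, p.1 n = 0) :
        ∀ᶠ n in hyperfilter ℕ, (p * q).1 n = 0 := by
      filter_upwards [h] with n hn
      change p.1 n * q.1 n = 0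
      rw [hn, zero_mul]
    have h0' (p q : (ℕ → CircleZero) × ZMod 4) (h : ∀ᶠ n in hyperfilter ℕ, q.1 n = 0) :
        ∀ᶠ n in hyperfilter ℕ, (p * q).1 n = 0 := mul_comm p q ▸ h0 q p h
    rintro p q (⟨h1, h2⟩ | ⟨h1, h2⟩ | rfl) (⟨h3, h4⟩ | ⟨h3, h4⟩ | rfl)
    · exact Or.inl ⟨h0 _ _ h1, by simp [h2]⟩
    · exact Or.inl ⟨h0 _ _ h1, by simp [h2]⟩
    · exact Or.inl ⟨h0 _ _ h1, by simp [h2]⟩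
    · exact Or.inl ⟨h0' _ _ h3, by simp [h4]⟩
    · refine Or.inr (Or.inl ⟨?_, by simp [h2, h4]⟩)
      filter_upwards [h1, h3] with n hn hn'
      change p.1 n * q.1 n = 1
      rw [hn, hn', one_mul]
    · exact Or.inr (Or.inr (Prod.ext (mul_zero _) (by simp [h2])))
    · exact Or.inl ⟨h0' _ _ h3, by simp [h4]⟩
    · exact Or.inr (Or.inr (Prod.ext (zero_mul _) (by simp [h4])))
    · exact Or.inl ⟨by simp, by decide⟩

namespace markedSeq

/-- The zero of `markedSeq`. -/
def bot : markedSeq := ⟨0, Or.inl ⟨by simp, rfl⟩⟩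

/-- The additional nilpotent element of `markedSeq`. -/
def nil : markedSeq := ⟨(0, 2), Or.inr (Or.inr rfl)⟩

/-- The sequence with a single nonzero entry, at the given place. -/
noncomputable def single (p : ℕ × ℚ) : markedSeq :=
  ⟨(Pi.single p.1 ((Multiplicative.ofAdd (p.2 : AddCircle (1 : ℚ)) : Multiplicative _) :
    CircleZero), 0), Or.inl ⟨by
      filter_upwards [hyperfilter_le_cofinite (finite_singleton p.1).compl_mem_cofinite] with n hn
      exact Pi.single_eq_of_ne hn _, rfl⟩⟩

theorem single_apply (p : ℕ × ℚ) : (single p).1.1 p.1 =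
    ((Multiplicative.ofAdd (p.2 : AddCircle (1 : ℚ)) : Multiplicative _) : CircleZero) :=
  Pi.single_eq_same _ _

theorem single_apply_ne_zero (p : ℕ × ℚ) : (single p).1.1 p.1 ≠ 0 := by
  rw [single_apply]
  exact WithZero.coe_ne_zero

theorem single_apply_of_ne (p : ℕ × ℚ) {n : ℕ} (h : n ≠ p.1) : (single p).1.1 n = 0 :=
  Pi.single_eq_of_ne h _

theorem single_mul_single (n : ℕ) (a b : ℚ) :
    single (n, a) * single (n, b) = single (n, a + b) := by
  refine Subtype.ext (Prod.ext (funext fun m => ?_) (mul_zero _))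
  change (single (n, a)).1.1 m * (single (n, b)).1.1 m = (single (n, a + b)).1.1 m
  by_cases h : m = n
  · subst h
    rw [single_apply (m, a), single_apply (m, b), single_apply (m, a + b)]
    rfl
  · rw [single_apply_of_ne (n, a) h, single_apply_of_ne (n, a + b) h, zero_mul]

theorem single_mul_single_of_ne {p q : ℕ × ℚ} (h : p.1 ≠ q.1) : single p * single q = bot := by
  refine Subtype.ext (Prod.ext (funext fun m => ?_) (mul_zero _))
  change (single p).1.1 m * (single q).1.1 m = 0
  by_cases hm : m = p.1
  · rw [single_apply_of_ne q (hm ▸ h), mul_zero]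
  · rw [single_apply_of_ne p hm, zero_mul]

theorem single_ne_single {p q : ℕ × ℚ} (h : p.1 = q.1 → 0 < q.2 - p.2 ∧ q.2 - p.2 < 1) :
    single p ≠ single q := by
  intro hpq
  have hpq1 : (single p).1.1 = (single q).1.1 := congrArg (fun a : markedSeq => a.1.1) hpq
  have h1 : p.1 = q.1 := by
    by_contra hne
    exact single_apply_ne_zero p (by rw [hpq1, single_apply_of_ne q hne])
  obtain ⟨h2, h3⟩ := h h1
  have h4 := congrFun hpq1 p.1
  rw [single_apply, h1, single_apply, WithZero.coe_inj] at h4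
  have h5 : (q.2 : AddCircle (1 : ℚ)) = p.2 := (Multiplicative.ofAdd.injective h4).symm
  rw [← sub_eq_zero, ← AddCircle.coe_sub, AddCircle.coe_eq_zero_iff] at h5
  obtain ⟨k, hk⟩ := h5
  rw [zsmul_one] at hk
  rw [← hk] at h2 h3
  have h6 : 0 < k := by exact_mod_cast h2
  have h7 : k < 1 := by exact_mod_cast h3
  lia

theorem single_ne_bot (p : ℕ × ℚ) : single p ≠ bot := fun h =>
  single_apply_ne_zero p (by rw [h]; rfl)

theorem single_ne_nil (p : ℕ × ℚ) : single p ≠ nil := fun h =>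
  single_apply_ne_zero p (by rw [h]; rfl)

theorem bot_ne_nil : bot ≠ nil := fun h =>
  absurd (congrArg (fun a : markedSeq => a.1.2) h) (by decide)

theorem eventually_single_ne {F : Filter (ℕ × ℚ)} (hF : Tendsto Prod.fst F (hyperfilter ℕ))
    (b : markedSeq) : ∀ᶠ p in F, single p ≠ b := by
  obtain ⟨b, ⟨h1, h2⟩ | ⟨h1, h2⟩ | rfl⟩ := b
  · filter_upwards [hF.eventually h1] with p hp h
    exact single_apply_ne_zero p (by rw [h]; exact hp)
  · refine .of_forall fun p h => ?_
    have := congrArg (fun a : markedSeq => a.1.2) h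
    rw [h2] at this
    exact absurd this (by decide : (0 : ZMod 4) ≠ 1)
  · exact .of_forall single_ne_nil

theorem eventually_mul_single {F : Filter (ℕ × ℚ)} (hF : Tendsto Prod.fst F (hyperfilter ℕ))
    (a : markedSeq) :
    ((∀ᶠ p in F, a * single p = bot) ∧ a * bot = bot ∧ a * nil = bot) ∨
      ((∀ᶠ p in F, a * single p = single p) ∧ a * bot = bot ∧ a * nil = nil) := by
  have hbot : a * bot = bot := Subtype.ext (mul_zero a.1)
  have hz {p : ℕ × ℚ} (h : a.1.1 p.1 = 0) : a * single p = bot := by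
    refine Subtype.ext (Prod.ext (funext fun n => ?_) (mul_zero _))
    change a.1.1 n * (single p).1.1 n = 0
    by_cases hn : n = p.1
    · rw [hn, h, zero_mul]
    · rw [single_apply_of_ne p hn, mul_zero]
  have hnil {z : markedSeq} (h1 : 0 = z.1.1) (h2 : a.1.2 * 2 = z.1.2) : a * nil = z :=
    Subtype.ext (Prod.ext ((mul_zero _).trans h1) h2)
  obtain ⟨h1, h2⟩ | ⟨h1, h2⟩ | h := a.2
  · refine Or.inl ⟨?_, hbot, ?_⟩
    · filter_upwards [hF.eventually h1] with p hp
      exact hz hp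
    · exact hnil rfl (by rw [h2, zero_mul]; rfl)
  · refine Or.inr ⟨?_, hbot, ?_⟩
    · filter_upwards [hF.eventually h1] with p hp
      refine Subtype.ext (Prod.ext (funext fun n => ?_) (mul_zero _))
      change a.1.1 n * (single p).1.1 n = (single p).1.1 n
      by_cases hn : n = p.1
      · rw [hn, hp, one_mul]
      · rw [single_apply_of_ne p hn, mul_zero]
    · exact hnil rfl (by rw [h2, one_mul]; rfl)
  · refine Or.inl ⟨.of_forall fun p => hz (by rw [h]; rfl), hbot, ?_⟩
    exact hnil rfl (by rw [h]; decide)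

open Classical in
/-- A topology in which the elements `single (n, θ n)` accumulate at `nil`. -/
theorem exists_topology {θ : ℕ → ℚ} (h0 : ∀ n, 0 < θ n)
    (hθ : Tendsto θ (hyperfilter ℕ) (𝓝 0)) :
    ∃ _ : TopologicalSpace markedSeq, ContinuousMul markedSeq ∧ T1Space markedSeq ∧
      HasClopenBasis markedSeq ∧
      Tendsto (fun n => single (n, θ n)) (hyperfilter ℕ) (𝓝 nil) := by
  let M : Filter (ℕ × ℚ) := (hyperfilter ℕ : Filter ℕ) ×ˢ 𝓝 0
  let S : Set (ℕ × ℚ) := {p | 2 * θ p.1 ≤ p.2 ∧ p.2 < 1}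
  let K : Filter (ℕ × ℚ) := map (fun n => (n, θ n)) (hyperfilter ℕ)
  let T : markedSeq → Filter (ℕ × ℚ) := fun a =>
    if a = bot then M ⊓ 𝓟 S else if a = nil then K else ⊥
  have hTbot : T bot = M ⊓ 𝓟 S := if_pos rfl
  have hTnil : T nil = K := (if_neg bot_ne_nil.symm).trans (if_pos rfl)
  have hTelse {a : markedSeq} (h1 : a ≠ bot) (h2 : a ≠ nil) : T a = ⊥ :=
    (if_neg h1).trans (if_neg h2)
  have hTM (a : markedSeq) : T a ≤ M := by
    by_cases h1 : a = bot
    · rw [h1, hTbot]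
      exact inf_le_left
    by_cases h2 : a = nil
    · rw [h2, hTnil]
      exact tendsto_id.prodMk hθ
    · rw [hTelse h1 h2]
      exact bot_le
  have hfst (a : markedSeq) : Tendsto Prod.fst (T a) (hyperfilter ℕ) := tendsto_fst.mono_left (hTM a)
  have hTθ (a : markedSeq) : ∀ᶠ p in T a, θ p.1 ≤ p.2 := by
    by_cases h1 : a = bot
    · rw [h1, hTbot]
      filter_upwards [mem_inf_of_right (mem_principal_self S)] with p hp
      linarith [hp.1, h0 p.1]
    by_cases h2 : a = nil
    · rw [h2, hTnil]
      exact eventually_map.2 (.of_forall fun n => le_rfl)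
    · rw [hTelse h1 h2]
      exact eventually_bot
  have hSK {p : ℕ × ℚ} (hp : p ∈ S) (n : ℕ) : single (n, θ n) ≠ single p := by
    refine single_ne_single fun h => ?_
    have h : n = p.1 := h
    subst h
    have := h0 p.1
    constructor <;> linarith [hp.1, hp.2]
  suffices h : ∃ _ : TopologicalSpace markedSeq, ContinuousMul markedSeq ∧ T1Space markedSeq ∧
      HasClopenBasis markedSeq ∧ ∀ a, map single (T a) ≤ 𝓝 a by
    obtain ⟨t, h1, h2, h3, h4⟩ := h
    refine ⟨t, h1, h2, h3, ?_⟩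
    have := h4 nil
    rw [hTnil, map_map] at this
    exact this
  refine exists_topology_of_tail (fun a => map single (T a))
    (fun a => eventually_map.2 (.of_forall fun p => ?_))
    (fun a b => eventually_single_ne (hfst a) b) (fun a => ?_) (fun a b => ?_) (fun a b => ?_)
  · exact (congrArg _ (hTelse (single_ne_bot p) (single_ne_nil p))).trans Filter.map_bot
  · by_cases ha1 : a = bot
    · refine ⟨single '' S, ?_, fun b hb => ?_⟩
      · rw [ha1, hTbot]
        exact image_mem_map (mem_inf_of_right (mem_principal_self S))
      · by_cases hb2 : b = nil
        · rw [hb2, hTnil]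
          refine mem_map.2 (mem_map.2 (univ_mem' fun n => ?_))
          rintro ⟨p, hp, h⟩
          exact hSK hp n h.symm
        · rw [hTelse (ha1 ▸ hb) hb2]
          exact mem_bot
    by_cases ha2 : a = nil
    · refine ⟨single '' range fun n => (n, θ n), ?_, fun b hb => ?_⟩
      · rw [ha2, hTnil]
        exact image_mem_map range_mem_map
      · by_cases hb1 : b = bot
        · rw [hb1, hTbot]
          refine mem_map.2 (mem_inf_of_right ?_)
          rintro p hp ⟨_, ⟨n, rfl⟩, h⟩
          exact hSK hp n h
        · rw [hTelse hb1 (ha2 ▸ hb)]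
          exact mem_bot
    · exact ⟨∅, by rw [hTelse ha1 ha2]; exact mem_bot, fun b _ => by simp⟩
  · by_cases hb : b = bot ∨ b = nil
    · rcases eventually_mul_single (hfst b) a with ⟨h1, h2, h3⟩ | ⟨h1, h2, h3⟩
      · have hab : a * b = bot := by rcases hb with rfl | rfl <;> assumption
        rw [hab, tendsto_map'_iff]
        exact (tendsto_pure.2 h1).mono_right le_sup_left
      · have hab : a * b = b := by rcases hb with rfl | rfl <;> assumption
        rw [hab, tendsto_map'_iff]
        exact (tendsto_map.congr' (h1.mono fun p hp => hp.symm)).mono_right le_sup_right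
    · push Not at hb
      simp only [hTelse hb.1 hb.2, Filter.map_bot, tendsto_bot]
  · by_cases ha : a = bot ∨ a = nil
    swap
    · push Not at ha
      simp only [hTelse ha.1 ha.2, Filter.map_bot, Filter.bot_prod, tendsto_bot]
    by_cases hb : b = bot ∨ b = nil
    swap
    · push Not at hb
      simp only [hTelse hb.1 hb.2, Filter.map_bot, Filter.prod_bot, tendsto_bot]
    have hab : a * b = bot := by
      rcases ha with rfl | rfl <;> rcases hb with rfl | rfl <;>
        exact Subtype.ext (Prod.ext (mul_zero _) (by decide))
    rw [hab, prod_map_map_eq, tendsto_map'_iff]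
    intro s hs
    have hs1 : bot ∈ s := mem_pure.1 hs.1
    have hs2 : {r | r ∈ S → single r ∈ s} ∈ M := by
      have : single ⁻¹' s ∈ M ⊓ 𝓟 S := hTbot ▸ hs.2
      exact mem_inf_principal.1 this
    have hsum : Tendsto (fun r : (ℕ × ℚ) × (ℕ × ℚ) => (r.1.1, r.1.2 + r.2.2)) (T a ×ˢ T b) M := by
      refine ((hfst a).comp tendsto_fst).prodMk ?_
      have := ((tendsto_snd.mono_left (hTM a)).comp (tendsto_fst (g := T b))).add
        ((tendsto_snd.mono_left (hTM b)).comp (tendsto_snd (f := T a)))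
      rwa [add_zero] at this
    have hlt : {r : ℕ × ℚ | r.2 < 1} ∈ M := tendsto_snd.eventually (gt_mem_nhds one_pos)
    rw [mem_map]
    filter_upwards [hsum hs2, hsum hlt, tendsto_fst.eventually (hTθ a),
      tendsto_snd.eventually (hTθ b)] with ⟨⟨n, c⟩, ⟨m, d⟩⟩ hr1 hr2 hr3 hr4
    change single (n, c) * single (m, d) ∈ s
    by_cases hnm : n = m
    · subst hnm
      rw [single_mul_single]
      refine hr1 ⟨?_, hr2⟩
      dsimp only at hr3 hr4 ⊢
      linarith
    · rw [single_mul_single_of_ne hnm]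
      exact hs1

end markedSeq

/-- Every element of finite order is detected by a character of the same order. -/
theorem exists_hom_addCircle_apply_eq {G : Type*} [CommGroup G] {g : G} (hg : 0 < orderOf g) :
    ∃ χ : G →* Multiplicative (AddCircle (1 : ℚ)),
      χ g = Multiplicative.ofAdd (((orderOf g : ℚ)⁻¹ : ℚ) : AddCircle (1 : ℚ)) := by
  let a : Additive G := Additive.ofMul g
  obtain ⟨c, hc⟩ := CharacterModule.dual_surjective_of_injective _
    (Submodule.injective_subtype (Submodule.span ℤ {a})) (CharacterModule.ofSpanSingleton a)
  refine ⟨AddMonoidHom.toMultiplicativeRight c, ?_⟩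
  have h1 : c a = CharacterModule.ofSpanSingleton a ⟨a, Submodule.mem_span_singleton_self a⟩ := by
    rw [← hc]
    rfl
  have h2 : c a = (((orderOf g : ℚ)⁻¹ : ℚ) : AddCircle (1 : ℚ)) := by
    rw [h1]
    erw [CharacterModule.ofSpanSingleton, LinearMap.toAddMonoidHom_coe, LinearMap.comp_apply,
      CharacterModule.intSpanEquivQuotAddOrderOf_apply_self, Submodule.liftQSpanSingleton_apply,
      AddMonoidHom.coe_toIntLinearMap, CharacterModule.int.divByNat,
      LinearMap.toSpanSingleton_apply_one]
    have : addOrderOf a = orderOf g := addOrderOf_ofMul_eq_orderOf g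
    rw [this, if_neg hg.ne']
  exact congrArg Multiplicative.ofAdd h2

section Bounded

variable {X : Type u} [CommSemigroup X]

open Classical in
theorem AbsolutelyTzSClosed.not_strictMono_orderOf (h : AbsolutelyTzSClosed X)
    (hp : IsPeriodic X) (hc : ChainFinite X) {e : ℕ → X} (he : ∀ n, e n * e n = e n)
    (hanti : ∀ m n, m ≠ n → e m * e n ≠ e m) (g : ∀ n, MaxGroup (he n)) :
    ¬ StrictMono fun n => orderOf (g n) := by
  intro hmono
  have hpos (n : ℕ) : 0 < orderOf (g n) := by
    obtain ⟨m, hm, hgm⟩ := hp.isOfFinOrder_maxGroup (he n) (g n)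
    exact orderOf_pos_iff.2 (isOfFinOrder_iff_pow_eq_one.2 ⟨m, hm, hgm⟩)
  obtain ⟨q, hq, hqx⟩ : ∃ q, 0 < q ∧ ∀ x, (∀ᶠ n in hyperfilter ℕ, hp.idem x * e n = e n) →
      ∀ᶠ n in hyperfilter ℕ, ∀ a : MaxGroup (he n), MaxGroup.val (he n) a = x * e n →
        a ^ q = 1 := by
    let F : Set X := {f | f * f = f ∧ ∀ᶠ n in hyperfilter ℕ, f * e n = e n}
    obtain hF | hF := F.eq_empty_or_nonempty
    · refine ⟨1, one_pos, fun x hx => ?_⟩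
      have : hp.idem x ∈ F := ⟨hp.idem_mul_self x, hx⟩
      rw [hF] at this
      exact this.elim
    obtain ⟨f, ⟨hff, hfe⟩, hmin⟩ := hc.exists_minimal hF fun p hp => hp.1
    obtain ⟨q, hq, hqf⟩ := h.exists_pow_eq_one hp hff
    refine ⟨q, hq, fun x hx => ?_⟩
    have hxf : hp.idem x * f = f := by
      refine hmin _ ⟨?_, ?_⟩ (by rw [mul_assoc, hff])
      · rw [mul_mul_mul_comm, hp.idem_mul_self, hff]
      · filter_upwards [hx, hfe] with n h1 h2
        rw [mul_assoc, h2, h1]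
    obtain ⟨q, rfl⟩ := Nat.exists_eq_add_one_of_ne_zero hq.ne'
    have hxq : spow (x * f) q = f := by
      have := MaxGroup.val_pow hff (MaxGroup.mk hff ((hp.mul_mem_maxSubgroup_iff hff).2 hxf)) q
      rw [hqf, MaxGroup.val_one, MaxGroup.val_mk] at this
      exact this.symm
    filter_upwards [hfe] with n hn a ha
    refine MaxGroup.val_injective (he n) ?_
    rw [MaxGroup.val_pow, MaxGroup.val_one, ha, ← hn, ← mul_assoc, mul_spow, hxq,
      spow_of_mul_self (he n)]
  choose χ hχ using fun n => exists_hom_addCircle_apply_eq (hpos n)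
  let ψ : ∀ n, X →ₙ* CircleZero := fun n =>
    ((WithZero.map' (χ n ^ q) : _ →*₀ CircleZero) : _ →ₙ* CircleZero).comp (hp.toMaxGroup (he n))
  have hψ0 {n : ℕ} {x : X} (hx : hp.idem x * e n ≠ e n) : ψ n x = 0 := by
    change WithZero.map' _ (hp.toMaxGroup (he n) x) = 0
    rw [hp.toMaxGroup_of_ne (he n) hx, map_zero]
  have hψ1 {x : X} (hx : ∀ᶠ n in hyperfilter ℕ, hp.idem x * e n = e n) :
      ∀ᶠ n in hyperfilter ℕ, ψ n x = 1 := by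
    filter_upwards [hx, hqx x hx] with n h1 h2
    obtain ⟨a, ha, hxa⟩ := hp.exists_toMaxGroup_eq (he n) h1
    change WithZero.map' _ (hp.toMaxGroup (he n) x) = 1
    rw [hxa, WithZero.map'_coe, MonoidHom.pow_apply, ← map_pow, h2 a ha, map_one]
    rfl
  let φ : X →ₙ* (ℕ → CircleZero) × ZMod 4 :=
    { toFun := fun x => (fun n => ψ n x,
        if ∀ᶠ n in hyperfilter ℕ, hp.idem x * e n = e n then 1 else 0)
      map_mul' := fun x y => by
        refine Prod.ext (funext fun n => map_mul (ψ n) x y) ?_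
        simp only [hp.idem_mul_mul_eq_iff, eventually_and, Prod.snd_mul]
        split_ifs <;> simp_all }
  have hφ1 {x : X} (hx : ∀ᶠ n in hyperfilter ℕ, hp.idem x * e n = e n) : (φ x).2 = 1 := if_pos hx
  have hφ0 {x : X} (hx : ¬ ∀ᶠ n in hyperfilter ℕ, hp.idem x * e n = e n) : (φ x).2 = 0 := if_neg hx
  have hφ (x : X) : φ x ∈ markedSeq := by
    by_cases hx : ∀ᶠ n in hyperfilter ℕ, hp.idem x * e n = e n
    · exact Or.inr (Or.inl ⟨hψ1 hx, hφ1 hx⟩)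
    · refine Or.inl ⟨?_, hφ0 hx⟩
      exact (Ultrafilter.eventually_not.2 hx).mono fun n hn => hψ0 hn
  let θ : ℕ → ℚ := fun n => q / orderOf (g n)
  have hθpos (n : ℕ) : 0 < θ n := div_pos (by exact_mod_cast hq) (by exact_mod_cast hpos n)
  have hθ : Tendsto θ (hyperfilter ℕ) (𝓝 0) :=
    (Tendsto.const_div_atTop ((tendsto_natCast_atTop_atTop (R := ℚ)).comp hmono.tendsto_atTop)
      _).mono_left Nat.hyperfilter_le_atTop
  obtain ⟨t, h1, h2, h3, h4⟩ := markedSeq.exists_topology hθpos hθ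
  have hcl := h.isClosed_range markedSeq h3 (φ.codRestrict markedSeq hφ)
  have hsingle (n : ℕ) : φ.codRestrict markedSeq hφ (MaxGroup.val (he n) (g n)) =
      markedSeq.single (n, θ n) := by
    have hidem := ((hp.mem_maxSubgroup_iff (he n)).1 (MaxGroup.val_mem (he n) (g n))).1
    have hne {m : ℕ} (hm : m ≠ n) : hp.idem (MaxGroup.val (he n) (g n)) * e m ≠ e m := by
      rw [hidem, mul_comm]
      exact hanti m n hm
    refine Subtype.ext (Prod.ext (funext fun m => ?_) (hφ0 fun hev => ?_))
    · change ψ m _ = (markedSeq.single (n, θ n)).1.1 m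
      by_cases hm : m = n
      · subst hm
        rw [markedSeq.single_apply (m, θ m)]
        change WithZero.map' _ (hp.toMaxGroup (he m) _) = _
        rw [hp.toMaxGroup_val, WithZero.map'_coe, MonoidHom.pow_apply, hχ, ← ofAdd_nsmul,
          ← AddCircle.coe_nsmul, nsmul_eq_mul, ← div_eq_mul_inv]
      · rw [markedSeq.single_apply_of_ne (n, θ n) hm, hψ0 (hne hm)]
    · obtain ⟨m, hm1, hm2⟩ := (hev.and
        (hyperfilter_le_cofinite (finite_singleton n).compl_mem_cofinite)).exists
      exact hne hm2 hm1
  obtain ⟨x, hx⟩ : markedSeq.nil ∈ range (φ.codRestrict markedSeq hφ) :=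
    hcl.mem_of_tendsto h4 (.of_forall fun n => ⟨_, hsingle n⟩)
  have hx : (φ x).2 = 2 := congrArg (fun a : markedSeq => a.1.2) hx
  by_cases hev : ∀ᶠ n in hyperfilter ℕ, hp.idem x * e n = e n
  · rw [hφ1 hev] at hx
    exact absurd hx (by decide)
  · rw [hφ0 hev] at hx
    exact absurd hx (by decide)

theorem AbsolutelyTzSClosed.boundedSemigroup (h : AbsolutelyTzSClosed X) (hp : IsPeriodic X)
    (hc : ChainFinite X) (hcl : CliffordPlusFinite X) : BoundedSemigroup X := by
  by_contra hunb
  choose m hm hmg using fun e : {e : X // e * e = e} => h.exists_pow_eq_one hp e.2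
  choose k hk using hp
  obtain ⟨f, -, hf⟩ := exists_seq_of_forall_finset_exists
    (α := Σ e : {e : X // e * e = e}, MaxGroup e.2) (fun _ => True)
    (fun a b => a.1 ≠ b.1 ∧ orderOf a.2 < orderOf b.2) (fun s _ => by
      by_contra! hs
      apply hunb
      let N : ℕ := ((∏ a ∈ s, m a.1) * (s.sup fun a => orderOf a.2).factorial) *
        ∏ x ∈ hcl.toFinset, (k x + 1)
      have hN : 0 < N := Nat.mul_pos (Nat.mul_pos (Finset.prod_pos fun a _ => hm a.1)
        (Nat.factorial_pos _)) (Finset.prod_pos fun x _ => Nat.succ_pos _)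
      have hdvd {x : X} {n : ℕ} (hx : spow x n ∈ idemSet X) (hn : n + 1 ∣ N) :
          spow x (N - 1) ∈ idemSet X := by
        obtain ⟨c, hc⟩ := hn
        obtain ⟨c, rfl⟩ := Nat.exists_eq_add_one_of_ne_zero
          (fun h0 : c = 0 => hN.ne' (by rw [hc, h0, mul_zero]))
        rw [hc, show (n + 1) * (c + 1) - 1 = n * c + n + c by
          rw [Nat.sub_eq_iff_eq_add (by nlinarith)]; ring, ← spow_spow, spow_of_mul_self hx]
        exact hx
      refine ⟨N - 1, fun x => ?_⟩
      by_cases hx : x ∈ cliffordPart X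
      · simp only [cliffordPart, mem_iUnion] at hx
        obtain ⟨e, he, hx⟩ := hx
        replace he : e * e = e := he
        let b : Σ e : {e : X // e * e = e}, MaxGroup e.2 := ⟨⟨e, he⟩, MaxGroup.mk he hx⟩
        have hb : b.2 ^ N = 1 := by
          obtain ⟨a, ha, hab⟩ := hs b trivial
          by_cases h1 : a.1 = b.1
          · obtain ⟨c, hc⟩ := ((Finset.dvd_prod_of_mem (fun a => m a.1) ha).mul_right _).mul_right
              (∏ x ∈ hcl.toFinset, (k x + 1))
            rw [show N = m a.1 * c from hc, pow_mul, h1, hmg, one_pow]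
          · have h2 : orderOf b.2 ≤ s.sup fun a => orderOf a.2 :=
              (hab h1).trans (Finset.le_sup (f := fun a => orderOf a.2) ha)
            refine orderOf_dvd_iff_pow_eq_one.1 (((Nat.dvd_factorial ?_ h2).mul_left _).mul_right _)
            exact orderOf_pos_iff.2 (isOfFinOrder_iff_pow_eq_one.2 ⟨_, hm _, hmg _ _⟩)
        have := MaxGroup.val_pow he b.2 (N - 1)
        rw [Nat.sub_add_cancel hN, hb, MaxGroup.val_one] at this
        rw [← show MaxGroup.val he b.2 = x from rfl, ← this]
        exact he
      · exact hdvd (hk x) ((Finset.dvd_prod_of_mem (fun x => k x + 1)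
          (hcl.mem_toFinset.2 ⟨mem_univ x, hx⟩)).mul_left _))
  have hinj : Function.Injective fun n => ((f n).1 : X) := by
    intro i j hij
    by_contra hne
    rcases Nat.lt_or_gt_of_ne hne with hlt | hlt
    · exact (hf i j hlt).1 (Subtype.ext hij)
    · exact (hf j i hlt).1 (Subtype.ext hij.symm)
  obtain ⟨i, hi, hanti⟩ := hc.exists_strictMono_antichain hinj fun n => (f n).1.2
  exact h.not_strictMono_orderOf (fun x => ⟨k x, hk x⟩) hc (fun n => (f (i n)).1.2) hanti
    (fun n => (f (i n)).2) fun a b hab => (hf _ _ (hi hab)).2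

end Bounded

/-! ### Infinite bounded abelian groups are not profinitely complete -/

section ProfiniteGroup

variable {G : Type u} [CommGroup G]

theorem index_range_powMonoidHom_ne_zero
    (hG : ∀ p : ℕ, p.Prime → (powMonoidHom p : G →* G).range.index ≠ 0) {n : ℕ} (hn : n ≠ 0) :
    (powMonoidHom n : G →* G).range.index ≠ 0 := by
  induction n using Nat.recOnMul with
  | zero => exact absurd rfl hn
  | one =>
    have : (powMonoidHom 1 : G →* G).range = ⊤ :=
      MonoidHom.range_eq_top.2 fun g => ⟨g, pow_one g⟩
    simp [this]
  | prime p hp => exact hG p hp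
  | mul a b ha hb =>
    have hab : (powMonoidHom (a * b) : G →* G).range =
        (powMonoidHom a : G →* G).range.map (powMonoidHom b) := by
      rw [← MonoidHom.range_comp]
      exact congrArg _ (MonoidHom.ext fun g => pow_mul g a b)
    rw [hab, Subgroup.index_map]
    exact mul_ne_zero (ne_zero_of_dvd_ne_zero (ha (left_ne_zero_of_mul hn))
      (Subgroup.index_dvd_of_le le_sup_left)) (hb (right_ne_zero_of_mul hn))

theorem exists_prime_index_range_powMonoidHom_eq_zero [Infinite G] {m : ℕ} (hm : m ≠ 0)
    (hG : ∀ g : G, g ^ m = 1) :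
    ∃ p : ℕ, p.Prime ∧ (powMonoidHom p : G →* G).range.index = 0 := by
  by_contra! h
  refine index_range_powMonoidHom_ne_zero h hm ?_
  have : (powMonoidHom m : G →* G).range = ⊥ := by
    rw [eq_bot_iff]
    rintro _ ⟨g, rfl⟩
    exact hG g
  rw [this, Subgroup.index_bot, Nat.card_eq_zero_of_infinite]

theorem exists_finiteIndex_notMem {m : ℕ} (hm : 0 < m) (hG : ∀ g : G, g ^ m = 1) {g : G}
    (hg : g ≠ 1) : ∃ N : Subgroup G, N.FiniteIndex ∧ g ∉ N := by
  obtain ⟨c, hc⟩ := CharacterModule.exists_character_apply_ne_zero_of_ne_zero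
    (a := Additive.ofMul g) hg
  let f : G →* Multiplicative (AddCircle (1 : ℚ)) := AddMonoidHom.toMultiplicativeRight c
  have : Finite f.range := by
    refine ((AddCircle.finite_torsion (1 : ℚ) hm).preimage
      Multiplicative.toAdd.injective.injOn).subset ?_
    rintro _ ⟨a, rfl⟩
    have h1 : f a ^ m = 1 := by rw [← map_pow, hG, map_one]
    exact congrArg Multiplicative.toAdd h1
  exact ⟨f.ker, inferInstance, fun h => hc (congrArg Multiplicative.toAdd (f.mem_ker.1 h))⟩

theorem exists_infinite_independent_addMonoidHom (K : Type*) [Field K] [Finite K] (V : Type u)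
    [AddCommGroup V] [Module K V] [Infinite V] :
    ∃ ι : Type u, Infinite ι ∧ ∃ κ : ι → V →+ K, (∀ v, {i | κ i v ≠ 0}.Finite) ∧
      ∀ s : Finset ι, ∃ v, ∀ i ∈ s, κ i v = 1 := by
  let b := Module.Basis.ofVectorSpace K V
  refine ⟨Module.Basis.ofVectorSpaceIndex K V, ?_, fun i => (b.coord i).toAddMonoidHom,
    fun v => (b.repr v).hasFiniteSupport, fun s => ⟨∑ i ∈ s, b i, fun i hi => ?_⟩⟩
  · by_contra hfin
    have : Finite (Module.Basis.ofVectorSpaceIndex K V) := not_infinite_iff_finite.1 hfin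
    exact not_finite_iff_infinite.2 ‹Infinite V› (Finite.of_equiv _ b.equivFun.symm.toEquiv)
  · change b.repr (∑ i ∈ s, b i) i = 1
    rw [map_sum, Finsupp.finsetSum_apply]
    simp_rw [b.repr_self]
    rw [Finset.sum_eq_single i (fun j _ hj => Finsupp.single_eq_of_ne hj.symm)
      (fun h => absurd hi h), Finsupp.single_eq_same]

/-- An infinite bounded abelian group has infinitely many independent characters of the same
prime order. -/
theorem exists_infinite_independent_zmod_hom [Infinite G] {m : ℕ} (hm : m ≠ 0)
    (hG : ∀ g : G, g ^ m = 1) :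
    ∃ p : ℕ, p.Prime ∧ ∃ ι : Type u, Infinite ι ∧ ∃ κ : ι → G →* Multiplicative (ZMod p),
      (∀ g, {i | κ i g ≠ 1}.Finite) ∧
      ∀ s : Finset ι, ∃ g, ∀ i ∈ s, κ i g = Multiplicative.ofAdd 1 := by
  obtain ⟨p, hp, hpG⟩ := exists_prime_index_range_powMonoidHom_eq_zero hm hG
  let N := (powMonoidHom p : G →* G).range
  have hV (v : Additive (G ⧸ N)) : p • v = 0 := by
    obtain ⟨g, hg⟩ := QuotientGroup.mk_surjective v.toMul
    have : v.toMul ^ p = 1 := by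
      rw [← hg, ← QuotientGroup.mk_pow]
      exact (QuotientGroup.eq_one_iff _).2 ⟨g, rfl⟩
    exact congrArg Additive.ofMul this
  have : Fact p.Prime := ⟨hp⟩
  let _ : Module (ZMod p) (Additive (G ⧸ N)) := AddCommGroup.zmodModule hV
  have : Infinite (Additive (G ⧸ N)) := by
    refine not_finite_iff_infinite.1 fun hfin => ?_
    have : Finite (G ⧸ N) := hfin
    exact (Subgroup.finiteIndex_of_finite_quotient (H := N)).index_ne_zero hpG
  obtain ⟨ι, hι, κ, hκ, hs⟩ := exists_infinite_independent_addMonoidHom (ZMod p)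
    (Additive (G ⧸ N))
  refine ⟨p, hp, ι, hι, fun i => (AddMonoidHom.toMultiplicativeRight (κ i)).comp
    (QuotientGroup.mk' N), fun g => (hκ (Additive.ofMul (g : G ⧸ N))).subset fun i hi h0 => ?_,
    fun s => ?_⟩
  · exact hi (congrArg Multiplicative.ofAdd h0)
  · obtain ⟨v, hv⟩ := hs s
    obtain ⟨g, hg⟩ := QuotientGroup.mk_surjective v.toMul
    refine ⟨g, fun i hi => congrArg Multiplicative.ofAdd ((congrArg (κ i) ?_).trans (hv i hi))⟩
    exact congrArg Additive.ofMul hg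

theorem exists_not_complete [Infinite G] {m : ℕ} (hm : m ≠ 0) (hG : ∀ g : G, g ^ m = 1) :
    ∃ t : {N : Subgroup G // N.FiniteIndex} → G,
      (∀ F : Set {N : Subgroup G // N.FiniteIndex}, F.Finite → ∃ g, ∀ N ∈ F, (t N)⁻¹ * g ∈ N.1) ∧
      ¬ ∃ g, ∀ N, (t N)⁻¹ * g ∈ N.1 := by
  obtain ⟨p, hp, ι, hι, κ, hκ, hs⟩ := exists_infinite_independent_zmod_hom hm hG
  have : Fact p.Prime := ⟨hp⟩
  choose g hg using hs
  let 𝓤 : Ultrafilter (Finset ι) := Ultrafilter.of atTop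
  have h𝓤 (i : ι) : ∀ᶠ s in 𝓤, κ i (g s) = Multiplicative.ofAdd 1 :=
    ((eventually_ge_atTop {i}).mono fun s hs => hg s i (Finset.singleton_subset_iff.1 hs)).filter_mono
      (Ultrafilter.of_le atTop)
  have hlim (N : {N : Subgroup G // N.FiniteIndex}) : ∃ t, ∀ᶠ s in 𝓤, t⁻¹ * g s ∈ N.1 := by
    have := N.2
    obtain ⟨a, ha⟩ := (𝓤.map fun s => (g s : G ⧸ N.1)).eq_pure_of_finite
    obtain ⟨t, rfl⟩ := QuotientGroup.mk_surjective a
    have : {(t : G ⧸ N.1)} ∈ 𝓤.map fun s => (g s : G ⧸ N.1) := ha ▸ mem_pure.2 rfl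
    refine ⟨t, (show ∀ᶠ s in 𝓤, (g s : G ⧸ N.1) = t from this).mono fun s hs => ?_⟩
    exact QuotientGroup.eq.1 hs.symm
  choose t ht using hlim
  refine ⟨t, fun F hF => ?_, ?_⟩
  · obtain ⟨s, hs⟩ := ((eventually_all_finite hF).2 fun N _ => ht N).exists
    exact ⟨g s, hs⟩
  · rintro ⟨x, hx⟩
    refine (infinite_univ (α := ι)) ((hκ x).subset fun i _ => ?_)
    have h1 := hx ⟨(κ i).ker, inferInstance⟩
    obtain ⟨s, hs1, hs2⟩ := ((ht ⟨(κ i).ker, inferInstance⟩).and (h𝓤 i)).exists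
    rw [MonoidHom.mem_ker, map_mul, map_inv, inv_mul_eq_one] at h1 hs1
    rw [mem_ofPred_eq, ← h1, hs1, hs2]
    exact fun h => one_ne_zero (α := ZMod p) (Multiplicative.ofAdd.injective h)

end ProfiniteGroup

section GroupFinite

variable {X : Type u} [CommSemigroup X] {e : X}

/-- The congruence identifying elements below `e` in the same orbit of a subgroup of the maximal
subgroup at `e`. -/
def orbitCon (he : e * e = e) (N : Subgroup (MaxGroup he)) : Con X where
  r x y := x = y ∨ e * x = x ∧ ∃ n ∈ N, MaxGroup.val he n * x = y
  iseqv :=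
    { refl := fun _ => Or.inl rfl
      symm := by
        rintro x _ (rfl | ⟨hx, n, hn, rfl⟩)
        · exact Or.inl rfl
        · refine Or.inr ⟨?_, n⁻¹, N.inv_mem hn, ?_⟩
          · rw [mul_left_comm, hx]
          · rw [← mul_assoc, ← map_mul, inv_mul_cancel, MaxGroup.val_one, hx]
      trans := by
        rintro x _ _ (rfl | ⟨hx, n, hn, rfl⟩) (rfl | ⟨hy, m, hm, rfl⟩)
        · exact Or.inl rfl
        · exact Or.inr ⟨hy, m, hm, rfl⟩
        · exact Or.inr ⟨hx, n, hn, rfl⟩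
        · exact Or.inr ⟨hx, m * n, N.mul_mem hm hn, by rw [map_mul, mul_assoc]⟩ }
  mul' := by
    rintro x _ x' _ (rfl | ⟨hx, n, hn, rfl⟩) (rfl | ⟨hy, m, hm, rfl⟩)
    · exact Or.inl rfl
    · exact Or.inr ⟨by rw [mul_left_comm, hy], m, hm, mul_left_comm _ _ _⟩
    · exact Or.inr ⟨by rw [← mul_assoc, hx], n, hn, (mul_assoc _ _ _).symm⟩
    · exact Or.inr ⟨by rw [← mul_assoc, hx], n * m, N.mul_mem hn hm, by
        rw [map_mul, mul_mul_mul_comm]⟩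

theorem orbitCon_iff {he : e * e = e} {N : Subgroup (MaxGroup he)} {x y : X} :
    orbitCon he N x y ↔ x = y ∨ e * x = x ∧ ∃ n ∈ N, MaxGroup.val he n * x = y := Iff.rfl

theorem MaxGroup.exists_finiteIndex_mul_eq (he : e * e = e) {x : X} (hx : e * x = x)
    (hfin : (range fun g => MaxGroup.val he g * x).Finite) :
    ∃ N : Subgroup (MaxGroup he), N.FiniteIndex ∧ ∀ n ∈ N, MaxGroup.val he n * x = x := by
  let _ : MulAction (MaxGroup he) {y : X // e * y = y} :=
    { smul := fun g y => ⟨MaxGroup.val he g * y, by rw [mul_left_comm, y.2]⟩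
      one_smul := fun y => Subtype.ext y.2
      mul_smul := fun g h y => Subtype.ext (by
        change MaxGroup.val he (g * h) * (y : X) = MaxGroup.val he g * (MaxGroup.val he h * y)
        rw [map_mul, mul_assoc]) }
  let y : {y : X // e * y = y} := ⟨x, hx⟩
  refine ⟨MulAction.stabilizer (MaxGroup he) y, ⟨?_⟩, fun n hn => congrArg Subtype.val hn⟩
  have : (MulAction.orbit (MaxGroup he) y).Finite := by
    refine (hfin.preimage Subtype.val_injective.injOn).subset ?_
    rintro _ ⟨g, rfl⟩
    exact ⟨g, rfl⟩
  rw [MulAction.index_stabilizer, Ne, Set.ncard_eq_zero this]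
  exact (MulAction.nonempty_orbit y).ne_empty

theorem InjectivelyTzSClosed.groupFinite (h : InjectivelyTzSClosed X) (hb : BoundedSemigroup X)
    (hc : ChainFinite X) (hcl : CliffordPlusFinite X) : GroupFinite X := by
  have hp := hb.isPeriodic
  obtain ⟨m, hm⟩ := hb
  by_contra hcon
  obtain ⟨e, ⟨he, hinf⟩, hmin⟩ : ∃ e ∈ {e : X | e * e = e ∧ (maxSubgroup X e).Infinite},
      ∀ p ∈ {e : X | e * e = e ∧ (maxSubgroup X e).Infinite}, p * e = p → p = e := by
    refine hc.exists_minimal ?_ fun p hp => hp.1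
    by_contra hemp
    refine hcon fun G hG => ?_
    obtain ⟨e, he, hGe⟩ := hG.exists_subset_maxSubgroup
    by_contra hinf
    exact hemp ⟨e, he, fun hfin => hinf (hfin.subset hGe)⟩
  have : Infinite (MaxGroup he) := hinf.to_subtype
  have hpow (g : MaxGroup he) : g ^ (m + 1) = 1 := by
    refine MaxGroup.val_injective he ?_
    rw [MaxGroup.val_pow, MaxGroup.val_one, hp.spow_eq_idem (hm _),
      ((hp.mem_maxSubgroup_iff he).1 (MaxGroup.val_mem he g)).1]
  have hone (g : MaxGroup he) : e * MaxGroup.val he g = MaxGroup.val he g := by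
    change MaxGroup.val he 1 * _ = _
    rw [← map_mul, one_mul]
  have hidem (g : MaxGroup he) {x : X} (hx : e * x = x) :
      hp.idem (MaxGroup.val he g * x) = hp.idem x := by
    conv_rhs => rw [← hx]
    rw [hp.idem_mul, hp.idem_mul, hp.idem_eq_of_mul_self he,
      ((hp.mem_maxSubgroup_iff he).1 (MaxGroup.val_mem he g)).1]
  have hstab {x : X} (hx : e * x = x) (hxe : x ∉ maxSubgroup X e) :
      (range fun g => MaxGroup.val he g * x).Finite := by
    by_cases hxc : x ∈ cliffordPart X
    · have hle : hp.idem x * e = hp.idem x := by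
        conv_rhs => rw [← hx]
        rw [hp.idem_mul, hp.idem_eq_of_mul_self he, mul_comm]
      have hxc' := hp.mem_cliffordPart_iff.1 hxc
      have hfin : (maxSubgroup X (hp.idem x)).Finite := by
        by_contra hinf
        have := hmin _ ⟨hp.idem_mul_self x, hinf⟩ hle
        exact hxe ((hp.mem_maxSubgroup_iff he).2 ⟨this, hx⟩)
      refine hfin.subset ?_
      rintro _ ⟨g, rfl⟩
      refine (hp.mem_maxSubgroup_iff (hp.idem_mul_self x)).2 ⟨hidem g hx, ?_⟩
      rw [mul_left_comm, hxc']
    · refine hcl.subset ?_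
      rintro _ ⟨g, rfl⟩
      refine ⟨mem_univ _, fun hg => hxc ?_⟩
      rw [hp.mem_cliffordPart_iff, hidem g hx, mul_left_comm] at hg
      have := congrArg (MaxGroup.val he g⁻¹ * ·) hg
      simp only [← mul_assoc, ← map_mul, inv_mul_cancel, MaxGroup.val_one] at this
      rw [hp.mem_cliffordPart_iff]
      rwa [mul_assoc, mul_left_comm, hx] at this
  obtain ⟨t, ht, hcomp⟩ := exists_not_complete m.succ_ne_zero hpow
  obtain ⟨x, hx⟩ := h.exists_forall_con
    (fun N : {N : Subgroup (MaxGroup he) // N.FiniteIndex} => orbitCon he N.1)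
    (fun x y hxy => by
      by_contra hne
      have hxy' (N : Subgroup (MaxGroup he)) (hN : N.FiniteIndex) :=
        (orbitCon_iff.1 (hxy ⟨N, hN⟩)).resolve_left hne
      obtain ⟨hx, n₀, -, hn₀⟩ := hxy' ⊤ inferInstance
      by_cases hxe : x ∈ maxSubgroup X e
      · have hn₀1 : n₀ ≠ 1 := by
          rintro rfl
          rw [MaxGroup.val_one, hx] at hn₀
          exact hne hn₀
        obtain ⟨N, hN, hn₀N⟩ := exists_finiteIndex_notMem m.succ_pos hpow hn₀1
        obtain ⟨-, n, hn, hnx⟩ := hxy' N hN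
        rw [← hn₀, ← MaxGroup.val_mk he hxe, ← map_mul, ← map_mul] at hnx
        exact hn₀N (mul_right_cancel (MaxGroup.val_injective he hnx) ▸ hn)
      · obtain ⟨N, hN, hNx⟩ := MaxGroup.exists_finiteIndex_mul_eq he hx (hstab hx hxe)
        obtain ⟨-, n, hn, hnx⟩ := hxy' N hN
        exact hne ((hNx n hn).symm.trans hnx))
    (fun N => MaxGroup.val he (t N))
    (fun F hF => by
      obtain ⟨g, hg⟩ := ht F hF
      refine ⟨MaxGroup.val he g, fun N hN => orbitCon_iff.2 (Or.inr ⟨hone g, t N * g⁻¹, ?_, ?_⟩)⟩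
      · have := N.1.inv_mem (hg N hN)
        rwa [mul_inv_rev, inv_inv, mul_comm] at this
      · rw [← map_mul, inv_mul_cancel_right])
  obtain ⟨a, rfl⟩ : ∃ a, MaxGroup.val he a = x := by
    rcases orbitCon_iff.1 (hx ⟨⊤, inferInstance⟩) with h1 | ⟨h1, n, -, h2⟩
    · exact ⟨_, h1.symm⟩
    · refine ⟨n⁻¹ * t ⟨⊤, inferInstance⟩, ?_⟩
      rw [map_mul, ← h2, ← mul_assoc, ← map_mul, inv_mul_cancel, MaxGroup.val_one, h1]
  refine hcomp ⟨a, fun N => ?_⟩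
  rcases orbitCon_iff.1 (hx N) with h1 | ⟨-, n, hn, h2⟩
  · rw [MaxGroup.val_injective he h1, inv_mul_cancel]
    exact N.1.one_mem
  · rw [← map_mul] at h2
    rw [← MaxGroup.val_injective he h2, mul_inv, inv_mul_cancel_right]
    exact N.1.inv_mem hn

end GroupFinite

theorem statement1 (X : Type u) [CommSemigroup X] :
    (AbsolutelyT2SClosed X ↔
      (ChainFinite X ∧ BoundedSemigroup X ∧ GroupFinite X ∧ CliffordPlusFinite X)) ∧
    (AbsolutelyTzSClosed X ↔
      (ChainFinite X ∧ BoundedSemigroup X ∧ GroupFinite X ∧ CliffordPlusFinite X)) ∧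
    ((IdeallyT2SClosed X ∧ InjectivelyT2SClosed X ∧ BoundedSemigroup X) ↔
      (ChainFinite X ∧ BoundedSemigroup X ∧ GroupFinite X ∧ CliffordPlusFinite X)) ∧
    ((IdeallyT2SClosed X ∧ GroupFinite X ∧ BoundedSemigroup X) ↔
      (ChainFinite X ∧ BoundedSemigroup X ∧ GroupFinite X ∧ CliffordPlusFinite X)) := by
  have h51 : ChainFinite X ∧ BoundedSemigroup X ∧ GroupFinite X ∧ CliffordPlusFinite X →
      AbsolutelyT2SClosed X := fun ⟨hc, hb, hg, hcl⟩ =>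
    absolutelyT2SClosed_of_chainFinite hc hb hg hcl
  have h25 (h : AbsolutelyTzSClosed X) :
      ChainFinite X ∧ BoundedSemigroup X ∧ GroupFinite X ∧ CliffordPlusFinite X := by
    have hp := h.isPeriodic
    have hc := h.ideallyTzSClosed.tzSClosed.chainFinite
    have hcl := h.ideallyTzSClosed.cliffordPlusFinite hp hc
    have hb := h.boundedSemigroup hp hc hcl
    exact ⟨hc, hb, h.injectivelyTzSClosed.groupFinite hb hc hcl, hcl⟩
  have hideal (h : IdeallyT2SClosed X) (hb : BoundedSemigroup X) :
      ChainFinite X ∧ CliffordPlusFinite X := by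
    have hc := h.ideallyTzSClosed.tzSClosed.chainFinite
    exact ⟨hc, h.ideallyTzSClosed.cliffordPlusFinite hb.isPeriodic hc⟩
  refine ⟨⟨fun h => h25 h.absolutelyTzSClosed, h51⟩,
    ⟨h25, fun h => (h51 h).absolutelyTzSClosed⟩, ⟨fun ⟨hi, hj, hb⟩ => ?_, fun h =>
      ⟨(h51 h).ideallyT2SClosed, (h51 h).injectivelyT2SClosed, h.2.1⟩⟩,
    ⟨fun ⟨hi, hg, hb⟩ => ?_, fun h => ⟨(h51 h).ideallyT2SClosed, h.2.2.1, h.2.1⟩⟩⟩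
  · obtain ⟨hc, hcl⟩ := hideal hi hb
    exact ⟨hc, hb, hj.injectivelyTzSClosed.groupFinite hb hc hcl, hcl⟩
  · obtain ⟨hc, hcl⟩ := hideal hi hb
    exact ⟨hc, hb, hg, hcl⟩
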